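/- arXiv:2510.05241 — 6 statements merged into one kernel-verified Lean document; each statement's English description precedes it below -/
import Mathlib

section
/- Let X be a finite-dimensional real inner product space, let f: X → ℝ ∪ {+∞} be a proper closed convex function that is μ-strongly convex with respect to the norm for some μ ≥ 0, and let φ: X → ℝ be a strictly convex function, differentiable on an open set containing dom f, with associated Bregman distance D(x, x̄) = φ(x) − φ(x̄) − ⟨∇φ(x̄), x − x̄⟩. Fix x̄ ∈ dom f and t > 0, and let x⁺ be a minimizer over X of the function x ↦ f(x) + t·D(x, x̄). Then for every x ∈ X it holds that f(x) + t·D(x, x̄) ≥ f(x⁺) + t·D(x⁺, x̄) + t·D(x, x⁺) + (μ/2)‖x − x⁺‖². -/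
open RealInnerProductSpace

/-- A function that attains a minimum over `[0, 1]` at `0` has nonnegative derivative at `0`. -/
theorem HasDerivAt.nonneg_of_forall_Ioo_le {h : ℝ → ℝ} {c : ℝ} (hd : HasDerivAt h c 0)
    (hmin : ∀ s ∈ Set.Ioo (0 : ℝ) 1, h 0 ≤ h s) : 0 ≤ c := by
  refine ge_of_tendsto hd.tendsto_slope_zero_right ?_
  filter_upwards [Ioo_mem_nhdsGT (zero_lt_one' ℝ)] with s hs
  have := hmin s hs
  rw [zero_add, smul_eq_mul]
  exact mul_nonneg (inv_nonneg.2 hs.1.le) (sub_nonneg.2 this)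

/-- The gradient gives the derivative along a line. -/
theorem HasGradientAt.hasDerivAt_add_smul {X : Type*} [NormedAddCommGroup X]
    [InnerProductSpace ℝ X] [CompleteSpace X] {φ : X → ℝ} {g p : X} (hφ : HasGradientAt φ g p)
    (d : X) : HasDerivAt (fun s : ℝ => φ (p + s • d)) ⟪g, d⟫ 0 := by
  have hline : HasDerivAt (fun s : ℝ => p + s • d) d 0 := by
    simpa using ((hasDerivAt_id (0 : ℝ)).smul_const d).const_add p
  have hφ' : HasFDerivAt φ (InnerProductSpace.toDual ℝ X g) (p + (0 : ℝ) • d) := by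
    simpa using hφ.hasFDerivAt
  simpa [Function.comp_def] using hφ'.comp_hasDerivAt (0 : ℝ) hline

theorem stmt_0
    {X : Type*} [NormedAddCommGroup X] [InnerProductSpace ℝ X] [FiniteDimensional ℝ X]
    (f : X → ℝ) (domf : Set X)
    (hdomf_ne : domf.Nonempty) (hdomf_closed : IsClosed domf) (hdomf_conv : Convex ℝ domf)
    (μ : ℝ) (hμ : 0 ≤ μ)
    (hf_sconv : ConvexOn ℝ domf (fun x => f x - μ / 2 * ‖x‖ ^ 2))
    (φ : X → ℝ) (gφ : X → X)
    (U : Set X) (hUopen : IsOpen U) (hUf : domf ⊆ U)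
    (hφdiff : ∀ x ∈ U, HasGradientAt φ (gφ x) x)
    (hφstrict : StrictConvexOn ℝ Set.univ φ)
    (D : X → X → ℝ)
    (hDdef : ∀ x x', D x x' = φ x - φ x' - ⟪gφ x', x - x'⟫)
    (xb : X) (hxb : xb ∈ domf) (t : ℝ) (ht : 0 < t)
    (xp : X) (hxp : xp ∈ domf)
    (hmin : ∀ x ∈ domf, f xp + t * D xp xb ≤ f x + t * D x xb) :
    ∀ x ∈ domf,
      f x + t * D x xb ≥ f xp + t * D xp xb + t * D x xp + μ / 2 * ‖x - xp‖ ^ 2 := by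
  intro x hx
  have hf : StrongConvexOn domf μ f := strongConvexOn_iff_convex.2 hf_sconv
  have hderiv : HasDerivAt
      (fun s : ℝ => s * (f x - f xp) - s * (1 - s) * (μ / 2 * ‖x - xp‖ ^ 2)
        + t * (φ (xp + s • (x - xp)) - s * ⟪gφ xb, x - xp⟫))
      ((f x - f xp) - μ / 2 * ‖x - xp‖ ^ 2 + t * (⟪gφ xp, x - xp⟫ - ⟪gφ xb, x - xp⟫)) 0 := by
    have hid := hasDerivAt_id (0 : ℝ)
    have h := ((hid.mul_const (f x - f xp)).sub
      ((hid.mul (hid.const_sub 1)).mul_const (μ / 2 * ‖x - xp‖ ^ 2))).add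
      ((((hφdiff xp (hUf hxp)).hasDerivAt_add_smul (x - xp)).sub
        (hid.mul_const ⟪gφ xb, x - xp⟫)).const_mul t)
    exact h.congr_deriv (by simp)
  have hnonneg := hderiv.nonneg_of_forall_Ioo_le fun s hs => by
    have hz : (1 - s) • xp + s • x = xp + s • (x - xp) := by module
    have hmem : xp + s • (x - xp) ∈ domf :=
      hz ▸ hdomf_conv hxp hx (sub_nonneg.2 hs.2.le) hs.1.le (by ring)
    have hconv := hf.2 hxp hx (sub_nonneg.2 hs.2.le) hs.1.le (by ring)
    rw [hz, norm_sub_rev xp x] at hconv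
    have hle := hmin _ hmem
    have hinner : ⟪gφ xb, xp + s • (x - xp) - xb⟫ = ⟪gφ xb, xp - xb⟫ + s * ⟪gφ xb, x - xp⟫ := by
      rw [add_sub_right_comm, inner_add_right, real_inner_smul_right]
    rw [hDdef, hDdef, hinner] at hle
    simp only [smul_eq_mul] at hconv
    simp only [zero_smul, add_zero]
    linarith
  have hinner : ⟪gφ xb, x - xb⟫ = ⟪gφ xb, xp - xb⟫ + ⟪gφ xb, x - xp⟫ := by
    rw [← inner_add_right, add_comm, sub_add_sub_cancel]
  rw [hDdef, hDdef, hDdef, hinner]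
  linarith
end

section
/- Suppose Assumption A holds. Fix reference points x̄ ∈ dom f, ȳ ∈ dom h, θ̄ ∈ Θ and positive parameters τ, σ, η, α, β, α⁺, β⁺, and define, for x ∈ dom f, y ∈ dom h, θ ∈ Θ, E(x, y; θ) = [Φ(x, y; θ) − Φ(x̄, y; θ) − ⟨∇_xΦ(x̄, y; θ), x − x̄⟩] + (1/(2α⁺))‖∇_yΦ(x, y; θ) − ∇_yΦ(x̄, y; θ)‖² + (1/β⁺)‖∇_yΦ(x̄, y; θ̄) − ∇_yΦ(x̄, ȳ; θ̄)‖² − (1/σ − η(α + β))·D_Y(y, ȳ) − (1/τ)·D_X(x, x̄). Then for all x ∈ dom f, y ∈ dom h, θ ∈ Θ, E(x, y; θ) ≤ ((L_yx)²/α⁺ + L_xx − 1/τ)·D_X(x, x̄) + (2(L_yy)²/β⁺ + η(α + β) − 1/σ)·D_Y(y, ȳ). Consequently, if 1/τ ≥ (L_yx)²/α⁺ + L_xx and 1/σ ≥ η(α + β) + 2(L_yy)²/β⁺, then E(x, y; θ) ≤ 0 for all such (x, y, θ). -/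
open RealInnerProductSpace

/-- The descent lemma on a convex set: a function whose gradient satisfies a Lipschitz bound
relative to the base point `a` is bounded above by its quadratic model at `a`. -/
theorem sub_sub_inner_le_of_lipschitz_gradient
    {X : Type*} [NormedAddCommGroup X] [InnerProductSpace ℝ X] [CompleteSpace X]
    {s : Set X} (hs : Convex ℝ s) {g : X → ℝ} {g' : X → X} {L : ℝ} {a b : X}
    (ha : a ∈ s) (hb : b ∈ s) (hg : ∀ x ∈ s, HasGradientAt g (g' x) x)
    (hL : ∀ x ∈ s, ‖g' x - g' a‖ ≤ L * ‖x - a‖) :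
    g b - g a - ⟪g' a, b - a⟫ ≤ L / 2 * ‖b - a‖ ^ 2 := by
  set d := b - a with hd
  have hmem : ∀ t ∈ Set.Icc (0 : ℝ) 1, a + t • d ∈ s := fun t ht =>
    hs.add_smul_sub_mem ha hb ht
  have hder : ∀ t ∈ Set.Icc (0 : ℝ) 1,
      HasDerivAt (fun t : ℝ => g (a + t • d) - t * ⟪g' a, d⟫ - L / 2 * ‖d‖ ^ 2 * t ^ 2)
        (⟪g' (a + t • d), d⟫ - ⟪g' a, d⟫ - L * ‖d‖ ^ 2 * t) t := by
    intro t ht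
    have hline : HasDerivAt (fun t : ℝ => a + t • d) d t := by
      simpa using ((hasDerivAt_id t).smul_const d).const_add a
    have hcomp := (hg _ (hmem t ht)).hasFDerivAt.comp_hasDerivAt t hline
    rw [InnerProductSpace.toDual_apply_apply] at hcomp
    refine ((hcomp.sub ((hasDerivAt_id t).mul_const ⟪g' a, d⟫)).sub
      ((hasDerivAt_pow 2 t).const_mul (L / 2 * ‖d‖ ^ 2))).congr_deriv ?_
    norm_num
    ring
  have hanti := antitoneOn_of_deriv_nonpos (convex_Icc (0 : ℝ) 1)
    (fun t ht => (hder t ht).continuousAt.continuousWithinAt)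
    (fun t ht => (hder t (interior_subset ht)).differentiableAt.differentiableWithinAt)
    (fun t ht => by
      have ht' := interior_subset ht
      rw [(hder t ht').deriv, ← inner_sub_left]
      have hbound := hL _ (hmem t ht')
      rw [add_sub_cancel_left, norm_smul, Real.norm_of_nonneg ht'.1] at hbound
      have hmul := mul_le_mul_of_nonneg_right hbound (norm_nonneg d)
      have hcs := real_inner_le_norm (g' (a + t • d) - g' a) d
      nlinarith)
  have hle := hanti (Set.left_mem_Icc.2 zero_le_one) (Set.right_mem_Icc.2 zero_le_one) zero_le_one
  have hab : a + d = b := by rw [hd]; abel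
  norm_num [hab] at hle
  linarith

theorem stmt_1
    {X : Type*} [NormedAddCommGroup X] [InnerProductSpace ℝ X] [FiniteDimensional ℝ X]
    {Y : Type*} [NormedAddCommGroup Y] [InnerProductSpace ℝ Y] [FiniteDimensional ℝ Y]
    {T : Type*} [NormedAddCommGroup T] [InnerProductSpace ℝ T] [FiniteDimensional ℝ T]
    (domf : Set X) (domh : Set Y) (Θset : Set T)
    (hdomf_ne : domf.Nonempty) (hdomh_ne : domh.Nonempty)
    (hdomf_conv : Convex ℝ domf) (hdomh_conv : Convex ℝ domh)
    (f : X → ℝ) (h : Y → ℝ)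
    (hfconv : ConvexOn ℝ domf f) (hhconv : ConvexOn ℝ domh h)
    (hflsc : LowerSemicontinuousOn f domf) (hhlsc : LowerSemicontinuousOn h domh)
    (Φ : X → Y → T → ℝ) (gradxΦ : X → Y → T → X) (gradyΦ : X → Y → T → Y)
    (Lxx Lxθ Lyx Lyy Lyθ : ℝ)
    (hLxx : 0 ≤ Lxx) (hLxθ : 0 ≤ Lxθ) (hLyx : 0 ≤ Lyx) (hLyy : 0 ≤ Lyy) (hLyθ : 0 ≤ Lyθ)
    (hΦconvx : ∀ y ∈ domh, ∀ θ ∈ Θset, ConvexOn ℝ domf (fun x => Φ x y θ))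
    (hΦconcy : ∀ x ∈ domf, ∀ θ ∈ Θset, ConcaveOn ℝ domh (fun y => Φ x y θ))
    (hgradx : ∀ x ∈ domf, ∀ y ∈ domh, ∀ θ ∈ Θset,
      HasGradientAt (fun x' => Φ x' y θ) (gradxΦ x y θ) x)
    (hgrady : ∀ x ∈ domf, ∀ y ∈ domh, ∀ θ ∈ Θset,
      HasGradientAt (fun y' => Φ x y' θ) (gradyΦ x y θ) y)
    (hLipx : ∀ x ∈ domf, ∀ x' ∈ domf, ∀ y ∈ domh, ∀ θ ∈ Θset, ∀ θ' ∈ Θset,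
      ‖gradxΦ x y θ - gradxΦ x' y θ'‖ ≤ Lxx * ‖x - x'‖ + Lxθ * ‖θ - θ'‖)
    (hLipy : ∀ x ∈ domf, ∀ x' ∈ domf, ∀ y ∈ domh, ∀ y' ∈ domh, ∀ θ ∈ Θset, ∀ θ' ∈ Θset,
      ‖gradyΦ x y θ - gradyΦ x' y' θ'‖ ≤ Lyx * ‖x - x'‖ + Lyy * ‖y - y'‖ + Lyθ * ‖θ - θ'‖)
    (φX : X → ℝ) (gφX : X → X) (UX : Set X) (hUXopen : IsOpen UX) (hUXf : domf ⊆ UX)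
    (hφX : ∀ x ∈ UX, HasGradientAt φX (gφX x) x)
    (DX : X → X → ℝ)
    (hDXdef : ∀ x x', DX x x' = φX x - φX x' - ⟪gφX x', x - x'⟫)
    (hDXlb : ∀ x, ∀ x' ∈ domf, 1 / 2 * ‖x - x'‖ ^ 2 ≤ DX x x')
    (φY : Y → ℝ) (gφY : Y → Y) (UY : Set Y) (hUYopen : IsOpen UY) (hUYh : domh ⊆ UY)
    (hφY : ∀ y ∈ UY, HasGradientAt φY (gφY y) y)
    (DY : Y → Y → ℝ)
    (hDYdef : ∀ y y', DY y y' = φY y - φY y' - ⟪gφY y', y - y'⟫)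
    (hDYlb : ∀ y, ∀ y' ∈ domh, 1 / 2 * ‖y - y'‖ ^ 2 ≤ DY y y')
    (xb : X) (hxb : xb ∈ domf) (yb : Y) (hyb : yb ∈ domh) (θb : T) (hθb : θb ∈ Θset)
    (τ σ η α β αp βp : ℝ)
    (hτ : 0 < τ) (hσ : 0 < σ) (hη : 0 < η) (hα : 0 < α) (hβ : 0 < β)
    (hαp : 0 < αp) (hβp : 0 < βp)
    (E : X → Y → T → ℝ)
    (hE : ∀ x y θ, E x y θ =
      (Φ x y θ - Φ xb y θ - ⟪gradxΦ xb y θ, x - xb⟫)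
        + 1 / (2 * αp) * ‖gradyΦ x y θ - gradyΦ xb y θ‖ ^ 2
        + 1 / βp * ‖gradyΦ xb y θb - gradyΦ xb yb θb‖ ^ 2
        - (1 / σ - η * (α + β)) * DY y yb
        - 1 / τ * DX x xb) :
    (∀ x ∈ domf, ∀ y ∈ domh, ∀ θ ∈ Θset,
      E x y θ ≤ (Lyx ^ 2 / αp + Lxx - 1 / τ) * DX x xb
        + (2 * Lyy ^ 2 / βp + η * (α + β) - 1 / σ) * DY y yb)
    ∧ ((1 / τ ≥ Lyx ^ 2 / αp + Lxx ∧ 1 / σ ≥ η * (α + β) + 2 * Lyy ^ 2 / βp) →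
        ∀ x ∈ domf, ∀ y ∈ domh, ∀ θ ∈ Θset, E x y θ ≤ 0) := by
  have hDX : ∀ x, ‖x - xb‖ ^ 2 ≤ 2 * DX x xb := fun x => by linarith [hDXlb x xb hxb]
  have hDY : ∀ y, ‖y - yb‖ ^ 2 ≤ 2 * DY y yb := fun y => by linarith [hDYlb y yb hyb]
  have key : ∀ x ∈ domf, ∀ y ∈ domh, ∀ θ ∈ Θset,
      E x y θ ≤ (Lyx ^ 2 / αp + Lxx - 1 / τ) * DX x xb
        + (2 * Lyy ^ 2 / βp + η * (α + β) - 1 / σ) * DY y yb := by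
    intro x hx y hy θ hθ
    have hdescent : Φ x y θ - Φ xb y θ - ⟪gradxΦ xb y θ, x - xb⟫ ≤ Lxx * DX x xb := by
      have hmodel := sub_sub_inner_le_of_lipschitz_gradient hdomf_conv hxb hx
        (fun z hz => hgradx z hz y hy θ hθ)
        (fun z hz => by simpa using hLipx z hz xb hxb y hy θ hθ θ hθ)
      linarith [mul_le_mul_of_nonneg_left (hDX x) hLxx]
    have hcross : 1 / (2 * αp) * ‖gradyΦ x y θ - gradyΦ xb y θ‖ ^ 2
        ≤ Lyx ^ 2 / αp * DX x xb := by
      have hlip : ‖gradyΦ x y θ - gradyΦ xb y θ‖ ≤ Lyx * ‖x - xb‖ := by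
        simpa using hLipy x hx xb hxb y hy y hy θ hθ θ hθ
      calc 1 / (2 * αp) * ‖gradyΦ x y θ - gradyΦ xb y θ‖ ^ 2
          ≤ 1 / (2 * αp) * (Lyx * ‖x - xb‖) ^ 2 := by gcongr
        _ = 1 / (2 * αp) * (Lyx ^ 2 * ‖x - xb‖ ^ 2) := by ring
        _ ≤ 1 / (2 * αp) * (Lyx ^ 2 * (2 * DX x xb)) := by gcongr; exact hDX x
        _ = Lyx ^ 2 / αp * DX x xb := by field_simp
    have hdual : 1 / βp * ‖gradyΦ xb y θb - gradyΦ xb yb θb‖ ^ 2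
        ≤ 2 * Lyy ^ 2 / βp * DY y yb := by
      have hlip : ‖gradyΦ xb y θb - gradyΦ xb yb θb‖ ≤ Lyy * ‖y - yb‖ := by
        simpa using hLipy xb hxb xb hxb y hy yb hyb θb hθb θb hθb
      calc 1 / βp * ‖gradyΦ xb y θb - gradyΦ xb yb θb‖ ^ 2
          ≤ 1 / βp * (Lyy * ‖y - yb‖) ^ 2 := by gcongr
        _ = 1 / βp * (Lyy ^ 2 * ‖y - yb‖ ^ 2) := by ring
        _ ≤ 1 / βp * (Lyy ^ 2 * (2 * DY y yb)) := by gcongr; exact hDY y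
        _ = 2 * Lyy ^ 2 / βp * DY y yb := by ring
    rw [hE]
    linarith
  refine ⟨key, fun ⟨hprimal, hdual⟩ x hx y hy θ hθ => (key x hx y hy θ hθ).trans ?_⟩
  have hDX0 : 0 ≤ DX x xb := by linarith [hDX x, sq_nonneg ‖x - xb‖]
  have hDY0 : 0 ≤ DY y yb := by linarith [hDY y, sq_nonneg ‖y - yb‖]
  exact add_nonpos (mul_nonpos_of_nonpos_of_nonneg (by linarith) hDX0)
    (mul_nonpos_of_nonpos_of_nonneg (by linarith) hDY0)
end

section
/- Let L_xx ≥ 0, L_yx > 0, L_yy > 0, γ > 0, and c_α, c_β > 0 with c_α + c_β ≤ 1. Define Ψ₁ = (−L_xx + √(L_xx² + 4(L_yx)²γ/c_α)) / (2(L_yx)²γ/c_α) and Ψ₂ = √(c_β(1 − (c_α + c_β))) / (√2 · γ · L_yy). Then for every τ with 0 < τ ≤ min{Ψ₁, Ψ₂}, setting σ = γτ, α⁺ = c_α/σ, and β⁺ = c_β/σ, one has 1/τ ≥ (L_yx)²/α⁺ + L_xx and 1/σ ≥ (c_α + c_β)/σ + 2(L_yy)²/β⁺; equivalently, L_xx·τ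 + ((L_yx)²/c_α)·γ·τ² ≤ 1 and (2(L_yy)²/c_β)·γ²·τ² ≤ 1 − (c_α + c_β). Moreover, if L_yy = 0, then for every τ with 0 < τ ≤ Ψ₁ the first inequality 1/τ ≥ (L_yx)²/α⁺ + L_xx holds. -/
open RealInnerProductSpace

lemma mul_add_mul_sq_le_one_of_le_root {a b t : ℝ} (ha : 0 < a) (hb : 0 ≤ b) (ht : 0 < t)
    (h : t ≤ (-b + √(b ^ 2 + 4 * a)) / (2 * a)) : b * t + a * t ^ 2 ≤ 1 := by
  rw [le_div_iff₀ (by positivity)] at h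
  have hsq : (2 * a * t + b) ^ 2 ≤ b ^ 2 + 4 * a :=
    (Real.le_sqrt (by positivity) (by positivity)).1 (by linarith)
  refine le_of_mul_le_mul_left ?_ (show 0 < 4 * a by positivity)
  linarith

lemma two_mul_sq_le_of_le_sqrt_div {c k t : ℝ} (hc : 0 ≤ c) (hk : 0 < k) (ht : 0 < t)
    (h : t ≤ √c / (√2 * k)) : 2 * (k * t) ^ 2 ≤ c := by
  rw [le_div_iff₀ (by positivity)] at h
  have hsq := (Real.le_sqrt (by positivity) hc).1 h
  have h2 : √2 ^ 2 = (2 : ℝ) := Real.sq_sqrt (by norm_num)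
  linear_combination hsq - (k * t) ^ 2 * h2

lemma sq_div_add_le_one_div {L l g c t : ℝ} (ht : 0 < t)
    (h : L * t + l ^ 2 / c * g * t ^ 2 ≤ 1) : l ^ 2 / (c / (g * t)) + L ≤ 1 / t := by
  rw [le_div_iff₀ ht, div_div_eq_mul_div]
  linear_combination h

lemma div_add_two_mul_sq_div_le_one_div {l g c d t : ℝ} (hg : 0 < g) (ht : 0 < t)
    (h : 2 * l ^ 2 / c * g ^ 2 * t ^ 2 ≤ 1 - d) :
    d / (g * t) + 2 * l ^ 2 / (c / (g * t)) ≤ 1 / (g * t) := by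
  have hgt : 0 < g * t := mul_pos hg ht
  rw [le_div_iff₀ hgt, add_mul, div_mul_cancel₀ _ hgt.ne', div_div_eq_mul_div]
  linear_combination h

theorem stmt_3
    (Lxx Lyx Lyy γ cα cβ : ℝ)
    (hLxx : 0 ≤ Lxx) (hLyx : 0 < Lyx) (hLyy : 0 ≤ Lyy) (hγ : 0 < γ)
    (hcα : 0 < cα) (hcβ : 0 < cβ) (hsum : cα + cβ ≤ 1)
    (Ψ₁ Ψ₂ : ℝ)
    (hΨ₁ : Ψ₁ = (-Lxx + Real.sqrt (Lxx ^ 2 + 4 * Lyx ^ 2 * γ / cα)) / (2 * Lyx ^ 2 * γ / cα))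
    (hΨ₂ : Ψ₂ = Real.sqrt (cβ * (1 - (cα + cβ))) / (Real.sqrt 2 * γ * Lyy)) :
    (0 < Lyy → ∀ τ : ℝ, 0 < τ → τ ≤ min Ψ₁ Ψ₂ →
      1 / τ ≥ Lyx ^ 2 / (cα / (γ * τ)) + Lxx
      ∧ 1 / (γ * τ) ≥ (cα + cβ) / (γ * τ) + 2 * Lyy ^ 2 / (cβ / (γ * τ))
      ∧ Lxx * τ + Lyx ^ 2 / cα * γ * τ ^ 2 ≤ 1
      ∧ 2 * Lyy ^ 2 / cβ * γ ^ 2 * τ ^ 2 ≤ 1 - (cα + cβ))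
    ∧ (Lyy = 0 → ∀ τ : ℝ, 0 < τ → τ ≤ Ψ₁ →
      1 / τ ≥ Lyx ^ 2 / (cα / (γ * τ)) + Lxx) := by
  have first : ∀ τ : ℝ, 0 < τ → τ ≤ Ψ₁ → Lxx * τ + Lyx ^ 2 / cα * γ * τ ^ 2 ≤ 1 := by
    intro τ hτ h
    refine mul_add_mul_sq_le_one_of_le_root (by positivity) hLxx hτ ?_
    rw [hΨ₁] at h
    convert h using 1
    ring_nf
  refine ⟨fun hL τ hτ h => ?_, fun _ τ hτ h => sq_div_add_le_one_div hτ (first τ hτ h)⟩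
  have h₁ := first τ hτ (h.trans (min_le_left _ _))
  have h₂ : 2 * Lyy ^ 2 / cβ * γ ^ 2 * τ ^ 2 ≤ 1 - (cα + cβ) := by
    have hle := h.trans (min_le_right _ _)
    rw [hΨ₂, mul_assoc] at hle
    have key := two_mul_sq_le_of_le_sqrt_div
      (mul_nonneg hcβ.le (sub_nonneg.2 hsum)) (mul_pos hγ hL) hτ hle
    calc 2 * Lyy ^ 2 / cβ * γ ^ 2 * τ ^ 2 = 2 * (γ * Lyy * τ) ^ 2 / cβ := by ring
      _ ≤ 1 - (cα + cβ) := by rw [div_le_iff₀ hcβ]; linarith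
  exact ⟨sq_div_add_le_one_div hτ h₁, div_add_two_mul_sq_div_le_one_div hγ hτ h₂, h₁, h₂⟩
end

section
/- Suppose Assumption A holds and let θ* ∈ Θ. Let {(x_k, y_k)}_{k ≥ 0} be generated by the Naive accelerated primal-dual iterates with constant step-sizes τ, σ > 0, momentum η ≥ 0, and an arbitrary sequence {θ_k} ⊆ Θ. Suppose there exist α, β > 0 with 1/τ ≥ (L_yx)²/α + L_xx and 1/σ ≥ η(α + β) + 2(L_yy)²/β, and let {t_k}_{k≥0} be positive reals with t₀ = 1, t_k/t_{k+1} = η, and t_k ≥ t_{k+1} for all k ≥ 0. For K ≥ 1 set T_K = Σ_{k=0}^{K−1} t_k, x̄_K = (1/T_K)Σ_{k=0}^{K−1} t_k x_{k+1}, ȳ_K = (1/T_K)Σ_{k=0}^{K−1} t_k y_{k+1}. Then for every x ∈ dom f and y ∈ dom h: L(x̄_K, y; θ*) − L(x, ȳ_K; θ*) ≤ (1/T_K)[(1/τ)·D_X(x, x₀) + (1/σ)·D_Y(y, y₀)] + (1/T_K)[L_yθ · Σ_{k=0}^{K−1} t_k(2η + 1)‖θ_k − θ*‖·‖y_{k+1}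 − y‖ + L_xθ · Σ_{k=0}^{K−1} t_k ‖θ_k − θ*‖·‖x_{k+1} − x‖]. -/
open RealInnerProductSpace

/-- First-order optimality for the sum of a convex function and a function differentiable at the
minimizer. -/
theorem ConvexOn.le_add_inner_of_forall_add_le
    {E : Type*} [NormedAddCommGroup E] [InnerProductSpace ℝ E] [CompleteSpace E]
    {S : Set E} {g φ : E → ℝ} {z G u : E} (hg : ConvexOn ℝ S g) (hz : z ∈ S)
    (hφ : HasGradientAt φ G z) (hmin : ∀ v ∈ S, g z + φ z ≤ g v + φ v) (hu : u ∈ S) :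
    g z ≤ g u + ⟪G, u - z⟫ := by
  have hline : HasDerivAt (fun s : ℝ => z + s • (u - z)) (u - z) 0 := by
    simpa using ((hasDerivAt_id (0 : ℝ)).smul_const (u - z)).const_add z
  have hcomp : HasDerivAt (fun s : ℝ => φ (z + s • (u - z))) ⟪G, u - z⟫ 0 := by
    have hF : HasFDerivAt φ (InnerProductSpace.toDual ℝ E G) (z + (0 : ℝ) • (u - z)) := by
      simpa using hφ.hasFDerivAt
    exact (hF.comp_hasDerivAt (0 : ℝ) hline).congr_deriv (by simp)
  have hψ : HasDerivAt (fun s : ℝ => φ (z + s • (u - z)) + s * (g u - g z))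
      (⟪G, u - z⟫ + (g u - g z)) 0 := by
    exact (hcomp.add ((hasDerivAt_id (0 : ℝ)).mul_const (g u - g z))).congr_deriv (by simp)
  have hlim := hψ.tendsto_slope.mono_left
    (nhdsWithin_mono (0 : ℝ) (show Set.Ioi (0 : ℝ) ⊆ {0}ᶜ from fun s hs => ne_of_gt hs))
  have hnonneg : 0 ≤ ⟪G, u - z⟫ + (g u - g z) := by
    refine ge_of_tendsto hlim ?_
    filter_upwards [Ioc_mem_nhdsGT (zero_lt_one : (0 : ℝ) < 1)] with s hs
    have hpt : z + s • (u - z) = (1 - s) • z + s • u := by module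
    have hS : z + s • (u - z) ∈ S := by
      rw [hpt]; exact hg.1 hz hu (by linarith [hs.2]) hs.1.le (by ring)
    have hconv : g (z + s • (u - z)) ≤ (1 - s) * g z + s * g u := by
      rw [hpt]; exact hg.2 hz hu (by linarith [hs.2]) hs.1.le (by ring)
    have hle := hmin _ hS
    rw [slope_def_field]
    refine div_nonneg ?_ (by linarith [hs.1])
    simp only [zero_smul, add_zero, zero_mul]
    linarith
  linarith

theorem ConvexOn.add_inner_gradient_le
    {E : Type*} [NormedAddCommGroup E] [InnerProductSpace ℝ E] [CompleteSpace E]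
    {S : Set E} {F : E → ℝ} {z G u : E} (hF : ConvexOn ℝ S F) (hz : z ∈ S)
    (hG : HasGradientAt F G z) (hu : u ∈ S) :
    F z + ⟪G, u - z⟫ ≤ F u := by
  have hneg : HasGradientAt (fun v => -F v) (-G) z := by
    rw [hasGradientAt_iff_hasFDerivAt, map_neg]
    exact hG.hasFDerivAt.neg
  have := hF.le_add_inner_of_forall_add_le hz hneg (fun v _ => by simp) hu
  rw [inner_neg_left] at this
  linarith

theorem ConcaveOn.le_add_inner_gradient
    {E : Type*} [NormedAddCommGroup E] [InnerProductSpace ℝ E] [CompleteSpace E]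
    {S : Set E} {F : E → ℝ} {z G u : E} (hF : ConcaveOn ℝ S F) (hz : z ∈ S)
    (hG : HasGradientAt F G z) (hu : u ∈ S) :
    F u ≤ F z + ⟪G, u - z⟫ := by
  have hneg : HasGradientAt (-F) (-G) z := by
    rw [hasGradientAt_iff_hasFDerivAt, map_neg]
    exact hG.hasFDerivAt.neg
  have := hF.neg.add_inner_gradient_le hz hneg hu
  simp only [inner_neg_left, Pi.neg_apply] at this
  linarith

/-- The descent lemma on a convex set. -/
theorem Convex.le_add_inner_add_of_lipschitz_gradient
    {E : Type*} [NormedAddCommGroup E] [InnerProductSpace ℝ E] [CompleteSpace E]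
    {S : Set E} (hS : Convex ℝ S) {F : E → ℝ} {G : E → E} {L : ℝ}
    (hG : ∀ w ∈ S, HasGradientAt F (G w) w)
    (hLip : ∀ w ∈ S, ∀ w' ∈ S, ‖G w - G w'‖ ≤ L * ‖w - w'‖)
    {u v : E} (hu : u ∈ S) (hv : v ∈ S) :
    F v ≤ F u + ⟪G u, v - u⟫ + L / 2 * ‖v - u‖ ^ 2 := by
  have hmem : ∀ s ∈ Set.Icc (0 : ℝ) 1, u + s • (v - u) ∈ S := fun s hs => by
    rw [show u + s • (v - u) = (1 - s) • u + s • v by module]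
    exact hS hu hv (by linarith [hs.2]) hs.1 (by ring)
  have hderiv : ∀ s ∈ Set.Icc (0 : ℝ) 1, HasDerivAt
      (fun s : ℝ => F (u + s • (v - u)) - s * ⟪G u, v - u⟫ - s ^ 2 * (L / 2 * ‖v - u‖ ^ 2))
      (⟪G (u + s • (v - u)), v - u⟫ - ⟪G u, v - u⟫ - 2 * s * (L / 2 * ‖v - u‖ ^ 2)) s := by
    intro s hs
    have hline : HasDerivAt (fun s : ℝ => u + s • (v - u)) (v - u) s := by
      simpa using ((hasDerivAt_id s).smul_const (v - u)).const_add u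
    have hcomp : HasDerivAt (fun s : ℝ => F (u + s • (v - u)))
        ⟪G (u + s • (v - u)), v - u⟫ s := by
      exact ((hG _ (hmem s hs)).hasFDerivAt.comp_hasDerivAt s hline).congr_deriv (by simp)
    have hlin := (hasDerivAt_id s).mul_const ⟪G u, v - u⟫
    have hsq := (hasDerivAt_pow 2 s).mul_const (L / 2 * ‖v - u‖ ^ 2)
    exact ((hcomp.sub hlin).sub hsq).congr_deriv (by simp)
  have hanti : AntitoneOn
      (fun s : ℝ => F (u + s • (v - u)) - s * ⟪G u, v - u⟫ - s ^ 2 * (L / 2 * ‖v - u‖ ^ 2))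
      (Set.Icc 0 1) := by
    refine antitoneOn_of_deriv_nonpos (convex_Icc 0 1)
      (fun s hs => (hderiv s hs).continuousAt.continuousWithinAt)
      (fun s hs => (hderiv s (interior_subset hs)).differentiableAt.differentiableWithinAt) ?_
    intro s hs
    have hs' := interior_subset hs
    rw [(hderiv s hs').deriv, ← inner_sub_left]
    have hCS := real_inner_le_norm (G (u + s • (v - u)) - G u) (v - u)
    have hL := hLip _ (hmem s hs') u hu
    rw [add_sub_cancel_left, norm_smul, Real.norm_of_nonneg hs'.1] at hL
    have := mul_le_mul_of_nonneg_right hL (norm_nonneg (v - u))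
    linarith
  have := hanti (Set.left_mem_Icc.2 zero_le_one) (Set.right_mem_Icc.2 zero_le_one) zero_le_one
  simp only [zero_smul, add_zero, one_smul, add_sub_cancel] at this
  linarith

/-- The three-point inequality for a Bregman proximal step. -/
theorem ConvexOn.bregman_prox_three_point
    {E : Type*} [NormedAddCommGroup E] [InnerProductSpace ℝ E] [CompleteSpace E]
    {S : Set E} {g φ : E → ℝ} {gφ : E → E} {D : E → E → ℝ} {a w z u : E} {c : ℝ}
    (hg : ConvexOn ℝ S g) (hz : z ∈ S) (hφ : HasGradientAt φ (gφ z) z)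
    (hD : ∀ p q, D p q = φ p - φ q - ⟪gφ q, p - q⟫)
    (hmin : ∀ v ∈ S, g z + ⟪a, z⟫ + c * D z w ≤ g v + ⟪a, v⟫ + c * D v w) (hu : u ∈ S) :
    g z + ⟪a, z - u⟫ ≤ g u + c * (D u w - D u z - D z w) := by
  have hgrad : HasGradientAt (fun v => ⟪a, v⟫ + c * D v w) (a + c • (gφ z - gφ w)) z := by
    rw [hasGradientAt_iff_hasFDerivAt, map_add, map_smul, map_sub]
    have hlin : ∀ b : E, HasFDerivAt (fun v => ⟪b, v⟫) (InnerProductSpace.toDual ℝ E b) z :=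
      fun b => (InnerProductSpace.toDual ℝ E b).hasFDerivAt
    have hDw : (fun v => D v w) = fun v => φ v - ⟪gφ w, v⟫ - (φ w - ⟪gφ w, w⟫) := by
      funext v
      rw [hD, inner_sub_right]
      ring
    have hDd : HasFDerivAt (fun v => D v w)
        (InnerProductSpace.toDual ℝ E (gφ z) - InnerProductSpace.toDual ℝ E (gφ w)) z := by
      rw [hDw]
      exact (hφ.hasFDerivAt.sub (hlin (gφ w))).sub_const _
    exact (hlin a).add (hDd.const_mul c)
  have := hg.le_add_inner_of_forall_add_le hz hgrad
    (fun v hv => by linarith [hmin v hv]) hu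
  simp only [hD, inner_add_left, inner_smul_left, inner_sub_left, inner_sub_right,
    conj_trivial] at this ⊢
  linarith

theorem real_inner_le_of_norm_le_add
    {E : Type*} [NormedAddCommGroup E] [InnerProductSpace ℝ E] {p q : E} {A a B b α β : ℝ}
    (hα : 0 < α) (hβ : 0 < β) (hp : ‖p‖ ≤ A * a + B * b) :
    ⟪p, q⟫ ≤ A ^ 2 / (2 * α) * a ^ 2 + B ^ 2 / (2 * β) * b ^ 2 + (α + β) / 2 * ‖q‖ ^ 2 := by
  have young : ∀ c γ : ℝ, 0 < γ → c * ‖q‖ ≤ c ^ 2 / (2 * γ) + γ / 2 * ‖q‖ ^ 2 := fun c γ hγ => by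
    have : c ^ 2 / (2 * γ) + γ / 2 * ‖q‖ ^ 2 - c * ‖q‖ = (c - γ * ‖q‖) ^ 2 / (2 * γ) := by
      field_simp
      ring
    have : 0 ≤ (c - γ * ‖q‖) ^ 2 / (2 * γ) := by positivity
    linarith
  have h₁ := young (A * a) α hα
  have h₂ := young (B * b) β hβ
  have h₃ := (real_inner_le_norm p q).trans (mul_le_mul_of_nonneg_right hp (norm_nonneg q))
  rw [mul_pow, mul_div_right_comm] at h₁ h₂
  linarith

theorem stmt_4
    {X : Type*} [NormedAddCommGroup X] [InnerProductSpace ℝ X] [FiniteDimensional ℝ X]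
    {Y : Type*} [NormedAddCommGroup Y] [InnerProductSpace ℝ Y] [FiniteDimensional ℝ Y]
    {T : Type*} [NormedAddCommGroup T] [InnerProductSpace ℝ T] [FiniteDimensional ℝ T]
    (domf : Set X) (domh : Set Y) (Θset : Set T)
    (hdomf_ne : domf.Nonempty) (hdomh_ne : domh.Nonempty)
    (hdomf_conv : Convex ℝ domf) (hdomh_conv : Convex ℝ domh)
    (f : X → ℝ) (h : Y → ℝ)
    (hfconv : ConvexOn ℝ domf f) (hhconv : ConvexOn ℝ domh h)
    (hflsc : LowerSemicontinuousOn f domf) (hhlsc : LowerSemicontinuousOn h domh)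
    (Φ : X → Y → T → ℝ) (gradxΦ : X → Y → T → X) (gradyΦ : X → Y → T → Y)
    (Lxx Lxθ Lyx Lyy Lyθ : ℝ)
    (hLxx : 0 ≤ Lxx) (hLxθ : 0 ≤ Lxθ) (hLyx : 0 ≤ Lyx) (hLyy : 0 ≤ Lyy) (hLyθ : 0 ≤ Lyθ)
    (hΦconvx : ∀ y ∈ domh, ∀ θ ∈ Θset, ConvexOn ℝ domf (fun x => Φ x y θ))
    (hΦconcy : ∀ x ∈ domf, ∀ θ ∈ Θset, ConcaveOn ℝ domh (fun y => Φ x y θ))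
    (hgradx : ∀ x ∈ domf, ∀ y ∈ domh, ∀ θ ∈ Θset,
      HasGradientAt (fun x' => Φ x' y θ) (gradxΦ x y θ) x)
    (hgrady : ∀ x ∈ domf, ∀ y ∈ domh, ∀ θ ∈ Θset,
      HasGradientAt (fun y' => Φ x y' θ) (gradyΦ x y θ) y)
    (hLipx : ∀ x ∈ domf, ∀ x' ∈ domf, ∀ y ∈ domh, ∀ θ ∈ Θset, ∀ θ' ∈ Θset,
      ‖gradxΦ x y θ - gradxΦ x' y θ'‖ ≤ Lxx * ‖x - x'‖ + Lxθ * ‖θ - θ'‖)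
    (hLipy : ∀ x ∈ domf, ∀ x' ∈ domf, ∀ y ∈ domh, ∀ y' ∈ domh, ∀ θ ∈ Θset, ∀ θ' ∈ Θset,
      ‖gradyΦ x y θ - gradyΦ x' y' θ'‖ ≤ Lyx * ‖x - x'‖ + Lyy * ‖y - y'‖ + Lyθ * ‖θ - θ'‖)
    (φX : X → ℝ) (gφX : X → X) (UX : Set X) (hUXopen : IsOpen UX) (hUXf : domf ⊆ UX)
    (hφX : ∀ x ∈ UX, HasGradientAt φX (gφX x) x)
    (DX : X → X → ℝ)
    (hDXdef : ∀ x x', DX x x' = φX x - φX x' - ⟪gφX x', x - x'⟫)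
    (hDXlb : ∀ x, ∀ x' ∈ domf, 1 / 2 * ‖x - x'‖ ^ 2 ≤ DX x x')
    (φY : Y → ℝ) (gφY : Y → Y) (UY : Set Y) (hUYopen : IsOpen UY) (hUYh : domh ⊆ UY)
    (hφY : ∀ y ∈ UY, HasGradientAt φY (gφY y) y)
    (DY : Y → Y → ℝ)
    (hDYdef : ∀ y y', DY y y' = φY y - φY y' - ⟪gφY y', y - y'⟫)
    (hDYlb : ∀ y, ∀ y' ∈ domh, 1 / 2 * ‖y - y'‖ ^ 2 ≤ DY y y')
    (θstar : T) (hθstar : θstar ∈ Θset)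
    (τ σ η : ℝ) (hτ : 0 < τ) (hσ : 0 < σ) (hη : 0 ≤ η)
    (xx : ℕ → X) (yy : ℕ → Y) (θθ : ℕ → T)
    (hxx : ∀ k, xx k ∈ domf) (hyy : ∀ k, yy k ∈ domh) (hθθ : ∀ k, θθ k ∈ Θset)
    (hyupd : ∀ k : ℕ, ∀ y' ∈ domh,
      h (yy (k + 1))
        - ⟪(1 + η) • gradyΦ (xx k) (yy k) (θθ k)
            - η • gradyΦ (xx (k - 1)) (yy (k - 1)) (θθ k), yy (k + 1)⟫
        + 1 / σ * DY (yy (k + 1)) (yy k)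
      ≤ h y'
        - ⟪(1 + η) • gradyΦ (xx k) (yy k) (θθ k)
            - η • gradyΦ (xx (k - 1)) (yy (k - 1)) (θθ k), y'⟫
        + 1 / σ * DY y' (yy k))
    (hxupd : ∀ k : ℕ, ∀ x' ∈ domf,
      f (xx (k + 1)) + ⟪gradxΦ (xx k) (yy (k + 1)) (θθ k), xx (k + 1)⟫
        + 1 / τ * DX (xx (k + 1)) (xx k)
      ≤ f x' + ⟪gradxΦ (xx k) (yy (k + 1)) (θθ k), x'⟫ + 1 / τ * DX x' (xx k))
    (α β : ℝ) (hα : 0 < α) (hβ : 0 < β)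
    (hstep1 : 1 / τ ≥ Lyx ^ 2 / α + Lxx)
    (hstep2 : 1 / σ ≥ η * (α + β) + 2 * Lyy ^ 2 / β)
    (t : ℕ → ℝ) (htpos : ∀ k, 0 < t k) (ht0 : t 0 = 1)
    (htratio : ∀ k : ℕ, t k / t (k + 1) = η)
    (htdec : ∀ k : ℕ, t (k + 1) ≤ t k) :
    ∀ K : ℕ, 1 ≤ K →
    ∀ TK : ℝ, TK = ∑ k ∈ Finset.range K, t k →
    ∀ xb : X, xb = TK⁻¹ • ∑ k ∈ Finset.range K, t k • xx (k + 1) →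
    ∀ yb : Y, yb = TK⁻¹ • ∑ k ∈ Finset.range K, t k • yy (k + 1) →
    ∀ x ∈ domf, ∀ y ∈ domh,
      (f xb + Φ xb y θstar - h y) - (f x + Φ x yb θstar - h yb)
      ≤ 1 / TK * (1 / τ * DX x (xx 0) + 1 / σ * DY y (yy 0))
        + 1 / TK *
          (Lyθ * ∑ k ∈ Finset.range K, t k * (2 * η + 1) * ‖θθ k - θstar‖ * ‖yy (k + 1) - y‖
            + Lxθ * ∑ k ∈ Finset.range K, t k * ‖θθ k - θstar‖ * ‖xx (k + 1) - x‖) := by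
  intro K hK TK hTK xb hxb yb hyb x hx y hy
  have hηt : ∀ k, η * t (k + 1) = t k := fun k => by
    rw [← htratio k, div_mul_cancel₀ _ (htpos (k + 1)).ne']
  have hTKpos : 0 < TK := by
    rw [hTK]
    exact Finset.sum_pos (fun k _ => htpos k) (Finset.nonempty_range_iff.2 (by omega))
  have hw0 : ∀ k ∈ Finset.range K, 0 ≤ TK⁻¹ * t k := fun k _ =>
    mul_nonneg (inv_nonneg.2 hTKpos.le) (htpos k).le
  have hw1 : ∑ k ∈ Finset.range K, TK⁻¹ * t k = 1 := by
    rw [← Finset.mul_sum, ← hTK, inv_mul_cancel₀ hTKpos.ne']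
  have hxb' : xb = ∑ k ∈ Finset.range K, (TK⁻¹ * t k) • xx (k + 1) := by
    simp only [hxb, Finset.smul_sum, smul_smul]
  have hyb' : yb = ∑ k ∈ Finset.range K, (TK⁻¹ * t k) • yy (k + 1) := by
    simp only [hyb, Finset.smul_sum, smul_smul]
  set gap : ℕ → ℝ := fun k => (f (xx (k + 1)) + Φ (xx (k + 1)) y θstar - h y)
    - (f x + Φ x (yy (k + 1)) θstar - h (yy (k + 1))) with hgap
  set err : ℕ → ℝ := fun k => Lyθ * ((2 * η + 1) * ‖θθ k - θstar‖ * ‖yy (k + 1) - y‖)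
    + Lxθ * (‖θθ k - θstar‖ * ‖xx (k + 1) - x‖) with herr
  set p : ℕ → Y := fun k => gradyΦ (xx k) (yy k) θstar
    - gradyΦ (xx (k - 1)) (yy (k - 1)) θstar with hp
  set V : ℕ → ℝ := fun k => t k * (1 / τ * DX x (xx k) + 1 / σ * DY y (yy k))
    + η * t k * (⟪p k, yy k - y⟫ + Lyx ^ 2 / (2 * α) * ‖xx k - xx (k - 1)‖ ^ 2
      + Lyy ^ 2 / (2 * β) * ‖yy k - yy (k - 1)‖ ^ 2) with hV
  have hpnorm : ∀ k, ‖p k‖ ≤ Lyx * ‖xx k - xx (k - 1)‖ + Lyy * ‖yy k - yy (k - 1)‖ := fun k => by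
    simpa using hLipy _ (hxx k) _ (hxx (k - 1)) _ (hyy k) _ (hyy (k - 1)) _ hθstar _ hθstar
  have hjensen : (f xb + Φ xb y θstar - h y) - (f x + Φ x yb θstar - h yb)
      ≤ 1 / TK * ∑ k ∈ Finset.range K, t k * gap k := by
    have h₁ := hfconv.map_sum_le hw0 hw1 (fun k _ => hxx (k + 1))
    have h₂ := (hΦconvx y hy θstar hθstar).map_sum_le hw0 hw1 (fun k _ => hxx (k + 1))
    have h₃ := hhconv.map_sum_le hw0 hw1 (fun k _ => hyy (k + 1))
    have h₄ := (hΦconcy x hx θstar hθstar).le_map_sum hw0 hw1 (fun k _ => hyy (k + 1))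
    rw [← hxb'] at h₁ h₂
    rw [← hyb'] at h₃ h₄
    simp only [smul_eq_mul] at h₁ h₂ h₃ h₄
    have hsplit : 1 / TK * ∑ k ∈ Finset.range K, t k * gap k
        = (∑ k ∈ Finset.range K, TK⁻¹ * t k * f (xx (k + 1)))
          + (∑ k ∈ Finset.range K, TK⁻¹ * t k * Φ (xx (k + 1)) y θstar)
          - (∑ k ∈ Finset.range K, TK⁻¹ * t k * Φ x (yy (k + 1)) θstar)
          + (∑ k ∈ Finset.range K, TK⁻¹ * t k * h (yy (k + 1)))
          - (∑ k ∈ Finset.range K, TK⁻¹ * t k) * (f x + h y) := by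
      rw [one_div, Finset.mul_sum, Finset.sum_mul, ← Finset.sum_add_distrib,
        ← Finset.sum_sub_distrib, ← Finset.sum_add_distrib, ← Finset.sum_sub_distrib]
      refine Finset.sum_congr rfl fun k _ => ?_
      simp only [hgap]
      ring
    rw [hsplit, hw1]
    linarith
  have hstep : ∀ k, t k * gap k ≤ t k * err k + (V k - V (k + 1)) := by
    intro k
    have hproxx := hfconv.bregman_prox_three_point (hxx (k + 1)) (hφX _ (hUXf (hxx (k + 1))))
      hDXdef (hxupd k) hx
    set s : Y := (1 + η) • gradyΦ (xx k) (yy k) (θθ k)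
      - η • gradyΦ (xx (k - 1)) (yy (k - 1)) (θθ k) with hs
    have hproxy := hhconv.bregman_prox_three_point (a := -s) (c := 1 / σ) (w := yy k)
      (hyy (k + 1)) (hφY _ (hUYh (hyy (k + 1)))) hDYdef
      (fun v hv => by simpa only [inner_neg_left, ← sub_eq_add_neg] using hyupd k v hv) hy
    have hconc := (hΦconcy _ (hxx (k + 1)) θstar hθstar).le_add_inner_gradient (hyy (k + 1))
      (hgrady _ (hxx (k + 1)) _ (hyy (k + 1)) θstar hθstar) hy
    have hconv := (hΦconvx _ (hyy (k + 1)) θstar hθstar).add_inner_gradient_le (hxx k)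
      (hgradx _ (hxx k) _ (hyy (k + 1)) θstar hθstar) hx
    have hdesc := hdomf_conv.le_add_inner_add_of_lipschitz_gradient (L := Lxx)
      (fun w hw => hgradx w hw _ (hyy (k + 1)) θstar hθstar)
      (fun w hw w' hw' => by
        simpa using hLipx w hw w' hw' _ (hyy (k + 1)) _ hθstar _ hθstar)
      (hxx k) (hxx (k + 1))
    have herrx : ⟪gradxΦ (xx k) (yy (k + 1)) θstar - gradxΦ (xx k) (yy (k + 1)) (θθ k),
        xx (k + 1) - x⟫ ≤ Lxθ * (‖θθ k - θstar‖ * ‖xx (k + 1) - x‖) := by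
      have hL := hLipx _ (hxx k) _ (hxx k) _ (hyy (k + 1)) _ hθstar _ (hθθ k)
      rw [sub_self, norm_zero, mul_zero, zero_add, norm_sub_rev θstar] at hL
      refine (real_inner_le_norm _ _).trans ?_
      rw [← mul_assoc]
      exact mul_le_mul_of_nonneg_right hL (norm_nonneg _)
    have hdelta : ∀ j, ‖gradyΦ (xx j) (yy j) (θθ k) - gradyΦ (xx j) (yy j) θstar‖
        ≤ Lyθ * ‖θθ k - θstar‖ := fun j => by
      simpa using hLipy _ (hxx j) _ (hxx j) _ (hyy j) _ (hyy j) _ (hθθ k) _ hθstar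
    have hsdecomp : s - gradyΦ (xx (k + 1)) (yy (k + 1)) θstar
        = ((1 + η) • (gradyΦ (xx k) (yy k) (θθ k) - gradyΦ (xx k) (yy k) θstar)
            - η • (gradyΦ (xx (k - 1)) (yy (k - 1)) (θθ k)
              - gradyΦ (xx (k - 1)) (yy (k - 1)) θstar))
          + (η • p k - p (k + 1)) := by
      simp only [hs, hp, Nat.add_sub_cancel]
      module
    have herry : ⟪(1 + η) • (gradyΦ (xx k) (yy k) (θθ k) - gradyΦ (xx k) (yy k) θstar)
            - η • (gradyΦ (xx (k - 1)) (yy (k - 1)) (θθ k)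
              - gradyΦ (xx (k - 1)) (yy (k - 1)) θstar), yy (k + 1) - y⟫
        ≤ Lyθ * ((2 * η + 1) * ‖θθ k - θstar‖ * ‖yy (k + 1) - y‖) := by
      refine (real_inner_le_norm _ _).trans ?_
      rw [← mul_assoc]
      refine mul_le_mul_of_nonneg_right ((norm_sub_le _ _).trans ?_) (norm_nonneg _)
      rw [norm_smul, norm_smul, Real.norm_of_nonneg hη, Real.norm_of_nonneg (by linarith)]
      have h₁ := mul_le_mul_of_nonneg_left (hdelta k) (by linarith : 0 ≤ 1 + η)
      have h₂ := mul_le_mul_of_nonneg_left (hdelta (k - 1)) hη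
      linarith
    have hyoung := mul_le_mul_of_nonneg_left
      (real_inner_le_of_norm_le_add (q := yy (k + 1) - yy k) hα hβ (hpnorm k)) hη
    have hyinner : ⟪s - gradyΦ (xx (k + 1)) (yy (k + 1)) θstar, yy (k + 1) - y⟫
        ≤ Lyθ * ((2 * η + 1) * ‖θθ k - θstar‖ * ‖yy (k + 1) - y‖)
          + η * ⟪p k, yy k - y⟫ + η * ⟪p k, yy (k + 1) - yy k⟫
          - ⟪p (k + 1), yy (k + 1) - y⟫ := by
      rw [hsdecomp, inner_add_left]
      have : ⟪η • p k - p (k + 1), yy (k + 1) - y⟫ = η * ⟪p k, yy k - y⟫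
          + η * ⟪p k, yy (k + 1) - yy k⟫ - ⟪p (k + 1), yy (k + 1) - y⟫ := by
        simp only [inner_sub_left, inner_sub_right, inner_smul_left, conj_trivial]
        ring
      linarith
    have hDx : (Lyx ^ 2 / (2 * α) + Lxx / 2) * ‖xx (k + 1) - xx k‖ ^ 2
        ≤ 1 / τ * DX (xx (k + 1)) (xx k) := by
      refine le_trans ?_ (mul_le_mul_of_nonneg_left (hDXlb (xx (k + 1)) (xx k) (hxx k))
        (one_div_pos.2 hτ).le)
      rw [← mul_assoc]
      refine mul_le_mul_of_nonneg_right ?_ (sq_nonneg _)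
      have : Lyx ^ 2 / (2 * α) = Lyx ^ 2 / α / 2 := by field_simp
      linarith
    have hDy : (η * ((α + β) / 2) + Lyy ^ 2 / (2 * β)) * ‖yy (k + 1) - yy k‖ ^ 2
        ≤ 1 / σ * DY (yy (k + 1)) (yy k) := by
      refine le_trans ?_ (mul_le_mul_of_nonneg_left (hDYlb (yy (k + 1)) (yy k) (hyy k))
        (one_div_pos.2 hσ).le)
      rw [← mul_assoc]
      refine mul_le_mul_of_nonneg_right ?_ (sq_nonneg _)
      have h₁ : 2 * Lyy ^ 2 / β = 4 * (Lyy ^ 2 / (2 * β)) := by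
        field_simp
        ring
      have h₂ : 0 ≤ Lyy ^ 2 / (2 * β) := by positivity
      linarith
    have hgapk : gap k ≤ err k
        + (1 / τ * DX x (xx k) + 1 / σ * DY y (yy k))
        - (1 / τ * DX x (xx (k + 1)) + 1 / σ * DY y (yy (k + 1)))
        + η * (⟪p k, yy k - y⟫ + Lyx ^ 2 / (2 * α) * ‖xx k - xx (k - 1)‖ ^ 2
          + Lyy ^ 2 / (2 * β) * ‖yy k - yy (k - 1)‖ ^ 2)
        - (⟪p (k + 1), yy (k + 1) - y⟫ + Lyx ^ 2 / (2 * α) * ‖xx (k + 1) - xx k‖ ^ 2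
          + Lyy ^ 2 / (2 * β) * ‖yy (k + 1) - yy k‖ ^ 2) := by
      simp only [hgap, herr]
      simp only [inner_neg_left, inner_sub_left, inner_sub_right] at *
      linarith
    have hmono : t (k + 1) * (1 / τ * DX x (xx (k + 1)) + 1 / σ * DY y (yy (k + 1)))
        ≤ t k * (1 / τ * DX x (xx (k + 1)) + 1 / σ * DY y (yy (k + 1))) := by
      refine mul_le_mul_of_nonneg_right (htdec k) (add_nonneg ?_ ?_)
      · exact mul_nonneg (one_div_pos.2 hτ).le
          (le_trans (by positivity) (hDXlb x (xx (k + 1)) (hxx (k + 1))))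
      · exact mul_nonneg (one_div_pos.2 hσ).le
          (le_trans (by positivity) (hDYlb y (yy (k + 1)) (hyy (k + 1))))
    have hmul := mul_le_mul_of_nonneg_left hgapk (htpos k).le
    simp only [hV, Nat.add_sub_cancel, hηt]
    linarith
  have hVnonneg : 0 ≤ V K := by
    have hyoung := real_inner_le_of_norm_le_add (q := yy K - y) (p := -p K) hα hβ
      (by simpa using hpnorm K)
    rw [inner_neg_left] at hyoung
    have hDx : 0 ≤ 1 / τ * DX x (xx K) :=
      mul_nonneg (one_div_pos.2 hτ).le (le_trans (by positivity) (hDXlb x (xx K) (hxx K)))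
    have hDy : η * ((α + β) / 2 * ‖yy K - y‖ ^ 2) ≤ 1 / σ * DY y (yy K) := by
      refine le_trans ?_ (mul_le_mul_of_nonneg_left (hDYlb y (yy K) (hyy K))
        (one_div_pos.2 hσ).le)
      rw [norm_sub_rev (yy K), ← mul_assoc, ← mul_assoc]
      refine mul_le_mul_of_nonneg_right ?_ (sq_nonneg _)
      have : 0 ≤ 2 * Lyy ^ 2 / β := by positivity
      linarith
    have hmul := mul_le_mul_of_nonneg_left hyoung hη
    have : 0 ≤ t K * ((1 / τ * DX x (xx K) + 1 / σ * DY y (yy K))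
        + η * (⟪p K, yy K - y⟫ + Lyx ^ 2 / (2 * α) * ‖xx K - xx (K - 1)‖ ^ 2
          + Lyy ^ 2 / (2 * β) * ‖yy K - yy (K - 1)‖ ^ 2)) :=
      mul_nonneg (htpos K).le (by linarith)
    simp only [hV]
    linarith
  have hV0 : V 0 = 1 / τ * DX x (xx 0) + 1 / σ * DY y (yy 0) := by
    simp [hV, hp, ht0]
  have hsum : ∑ k ∈ Finset.range K, t k * gap k
      ≤ (∑ k ∈ Finset.range K, t k * err k) + V 0 := by
    have := Finset.sum_le_sum fun k (_ : k ∈ Finset.range K) => hstep k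
    rw [Finset.sum_add_distrib, Finset.sum_range_sub'] at this
    linarith
  have herrsum : ∑ k ∈ Finset.range K, t k * err k
      = Lyθ * ∑ k ∈ Finset.range K, t k * (2 * η + 1) * ‖θθ k - θstar‖ * ‖yy (k + 1) - y‖
        + Lxθ * ∑ k ∈ Finset.range K, t k * ‖θθ k - θstar‖ * ‖xx (k + 1) - x‖ := by
    rw [Finset.mul_sum, Finset.mul_sum, ← Finset.sum_add_distrib]
    refine Finset.sum_congr rfl fun k _ => ?_
    simp only [herr]
    ring
  refine hjensen.trans ?_
  rw [← mul_add, ← hV0, ← herrsum, add_comm (V 0)]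
  exact mul_le_mul_of_nonneg_left hsum (one_div_pos.2 hTKpos).le
end

section
/- Suppose Assumptions A and B hold and let θ* ∈ Θ. Let {(x_k, y_k)} be generated by the Learning-aware accelerated primal-dual iterates with positive step-sizes {τ_k, σ_k}, momentum parameters {η_k}, positive parameters {α_k, β_k}, and parameter estimates {θ_k} ⊆ Θ. Suppose: (i) E_k(x_{k+1}, y_{k+1}; θ_{k+1}) ≤ 0 for all 0 ≤ k ≤ K−1; (ii) there are positive reals {t_k} with t₀ = 1, t_k/τ_k ≥ t_{k+1}/τ_{k+1}, t_k/σ_k ≥ t_{k+1}/σ_{k+1}, and t_k/t_{k+1} = η_{k+1} for all k ≥ 0; and (iii) 1/σ_K ≥ η_K(α_K + β_K). For K ≥ 1 set T_K = Σ_{k=0}^{K−1} t_k, x̄_K = (1/T_K)Σ_{k=0}^{K−1} t_k x_{k+1}, ȳ_K = (1/T_K)Σ_{k=0}^{K−1} t_k y_{k+1}. Then for every x ∈ dom f and y ∈ dom h: L(x̄_K, y; θ*) − L(x, ȳ_K; θ*) ≤ (1/T_K)[(1/τ₀)·D_X(x, x₀) + (1/σ₀)·D_Y(y, y₀)] + (2L_θ/T_K)·Σ_{k=0}^{K−1}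 t_k ‖θ_{k+1} − θ*‖ + ((L_yθ)²/T_K)·Σ_{k=0}^{K−1} (t_k/β_{k+1})·‖θ_{k+1} − θ_k‖². -/
open RealInnerProductSpace

section FirstOrder

variable {E : Type*} [NormedAddCommGroup E] [InnerProductSpace ℝ E] [CompleteSpace E]

/-- First-order optimality condition for the sum of a convex and a differentiable function. -/
theorem ConvexOn.le_add_inner_of_isMinOn_add {s : Set E} {F G : E → ℝ} {g u v : E}
    (hF : ConvexOn ℝ s F) (hG : HasGradientAt G g u) (hu : u ∈ s) (hv : v ∈ s)
    (hmin : ∀ w ∈ s, F u + G u ≤ F w + G w) : F u ≤ F v + ⟪g, v - u⟫ := by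
  have hline : HasDerivAt (fun t : ℝ => u + t • (v - u)) (v - u) 0 := by
    simpa using ((hasDerivAt_id (0 : ℝ)).smul_const (v - u)).const_add u
  have hd : HasDerivAt (fun t : ℝ => G (u + t • (v - u))) ⟪g, v - u⟫ 0 := by
    have hG' : HasFDerivAt G (InnerProductSpace.toDual ℝ E g) (u + (0 : ℝ) • (v - u)) := by
      simpa using hG.hasFDerivAt
    exact (hG'.comp_hasDerivAt (0 : ℝ) hline).congr_deriv (by simp)
  have hlim := hd.tendsto_slope_zero_right
  have hbound : F u - F v ≤ ⟪g, v - u⟫ := by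
    refine ge_of_tendsto hlim ?_
    filter_upwards [Ioc_mem_nhdsGT (show (0 : ℝ) < 1 by norm_num)] with t ht
    have hpt : (1 - t) • u + t • v = u + t • (v - u) := by module
    have hconv := hF.2 hu hv (sub_nonneg.2 ht.2) ht.1.le (by ring)
    have hmem := hF.1 hu hv (sub_nonneg.2 ht.2) ht.1.le (by ring)
    rw [hpt] at hconv hmem
    have := hmin _ hmem
    simp only [smul_eq_mul, zero_add, zero_smul, add_zero] at hconv ⊢
    rw [inv_mul_eq_div, le_div_iff₀ ht.1]
    linarith
  linarith

theorem ConvexOn.add_inner_le_of_hasGradientAt {s : Set E} {F : E → ℝ} {g u v : E}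
    (hF : ConvexOn ℝ s F) (hg : HasGradientAt F g u) (hu : u ∈ s) (hv : v ∈ s) :
    F u + ⟪g, v - u⟫ ≤ F v := by
  have hneg : HasGradientAt (fun w => -F w) (-g) u := by
    rw [hasGradientAt_iff_hasFDerivAt, map_neg]
    exact hg.hasFDerivAt.neg
  have := hF.le_add_inner_of_isMinOn_add hneg hu hv (fun w _ => by simp)
  rw [inner_neg_left] at this
  linarith

theorem ConcaveOn.le_add_inner_of_hasGradientAt {s : Set E} {F : E → ℝ} {g u v : E}
    (hF : ConcaveOn ℝ s F) (hg : HasGradientAt F g u) (hu : u ∈ s) (hv : v ∈ s) :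
    F v ≤ F u + ⟪g, v - u⟫ := by
  have hneg : HasGradientAt (fun w => -F w) (-g) u := by
    rw [hasGradientAt_iff_hasFDerivAt, map_neg]
    exact hg.hasFDerivAt.neg
  have := hF.neg.add_inner_le_of_hasGradientAt hneg hu hv
  rw [inner_neg_left] at this
  simp only [Pi.neg_apply] at this
  linarith

/-- The three-point inequality for a Bregman proximal step. -/
theorem ConvexOn.three_point_of_bregman_prox {s : Set E} {F φ : E → ℝ} {gφ : E → E}
    {D : E → E → ℝ} (hD : ∀ w w', D w w' = φ w - φ w' - ⟪gφ w', w - w'⟫)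
    {p u c v : E} {r : ℝ} (hF : ConvexOn ℝ s F) (hφ : HasGradientAt φ (gφ u) u)
    (hu : u ∈ s) (hv : v ∈ s)
    (hmin : ∀ w ∈ s, F u + ⟪p, u⟫ + r * D u c ≤ F w + ⟪p, w⟫ + r * D w c) :
    F u + ⟪p, u⟫ ≤ F v + ⟪p, v⟫ + r * (D v c - D v u - D u c) := by
  have hG : HasGradientAt (fun w => ⟪p, w⟫ + r * (φ w - φ c - ⟪gφ c, w - c⟫))
      (p + r • (gφ u - gφ c)) u := by
    rw [hasGradientAt_iff_hasFDerivAt]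
    have h1 : HasFDerivAt (fun w => ⟪p, w⟫) (InnerProductSpace.toDual ℝ E p) u :=
      (InnerProductSpace.toDual ℝ E p).hasFDerivAt
    have h2 : HasFDerivAt (fun w => ⟪gφ c, w - c⟫) (InnerProductSpace.toDual ℝ E (gφ c)) u :=
      (InnerProductSpace.toDual ℝ E (gφ c)).hasFDerivAt.comp u (hasFDerivAt_sub_const c)
    have h3 := h1.add (((hφ.hasFDerivAt.sub_const (φ c)).sub h2).const_mul r)
    refine h3.congr_fderiv ?_
    ext w
    simp
  have key := hF.le_add_inner_of_isMinOn_add hG hu hv (fun w hw => by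
    have := hmin w hw
    rw [hD, hD] at this
    linarith)
  rw [hD, hD, hD]
  simp only [inner_add_left, inner_sub_left, inner_sub_right, real_inner_smul_left] at key ⊢
  nlinarith

end FirstOrder

theorem real_inner_le_young {E : Type*} [NormedAddCommGroup E] [InnerProductSpace ℝ E]
    (a v : E) {c : ℝ} (hc : 0 < c) :
    ⟪a, v⟫ ≤ 1 / (2 * c) * ‖a‖ ^ 2 + c / 2 * ‖v‖ ^ 2 := by
  have h1 := real_inner_le_norm a v
  have h2 : 1 / (2 * c) * ‖a‖ ^ 2 + c / 2 * ‖v‖ ^ 2 - ‖a‖ * ‖v‖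
      = 1 / (2 * c) * (‖a‖ - c * ‖v‖) ^ 2 := by
    field_simp
    ring
  have h3 : 0 ≤ 1 / (2 * c) * (‖a‖ - c * ‖v‖) ^ 2 := by positivity
  linarith

theorem real_inner_add_add_le_young {E : Type*} [NormedAddCommGroup E] [InnerProductSpace ℝ E]
    (a b d v : E) {α β : ℝ} (hα : 0 < α) (hβ : 0 < β) :
    ⟪a + b + d, v⟫ ≤ 1 / (2 * α) * ‖a‖ ^ 2 + 1 / β * ‖b‖ ^ 2 + 1 / β * ‖d‖ ^ 2
      + (α + β) * (1 / 2 * ‖v‖ ^ 2) := by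
  have ha := real_inner_le_young a v hα
  have hb := real_inner_le_young b v (half_pos hβ)
  have hd := real_inner_le_young d v (half_pos hβ)
  rw [mul_div_cancel₀ _ (two_ne_zero' ℝ)] at hb hd
  rw [inner_add_left, inner_add_left]
  linarith

/-- Jensen's inequality for a weighted average given by scalar multiplication with `W⁻¹`. -/
theorem ConvexOn.mul_map_average_le {E ι : Type*} [AddCommGroup E] [Module ℝ E] {s : Set E}
    {F : E → ℝ} (hF : ConvexOn ℝ s F) {I : Finset ι} {w : ι → ℝ} {p : ι → E}
    (hw : ∀ i ∈ I, 0 ≤ w i) (hW : 0 < ∑ i ∈ I, w i) (hp : ∀ i ∈ I, p i ∈ s) :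
    (∑ i ∈ I, w i) * F ((∑ i ∈ I, w i)⁻¹ • ∑ i ∈ I, w i • p i) ≤ ∑ i ∈ I, w i * F (p i) := by
  have := hF.map_centerMass_le hw hW hp
  simp only [Finset.centerMass, smul_eq_mul, Function.comp_apply] at this
  rwa [inv_mul_eq_div, le_div_iff₀' hW] at this

theorem stmt_6
    {X : Type*} [NormedAddCommGroup X] [InnerProductSpace ℝ X] [FiniteDimensional ℝ X]
    {Y : Type*} [NormedAddCommGroup Y] [InnerProductSpace ℝ Y] [FiniteDimensional ℝ Y]
    {T : Type*} [NormedAddCommGroup T] [InnerProductSpace ℝ T] [FiniteDimensional ℝ T]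
    (domf : Set X) (domh : Set Y) (Θset : Set T)
    (hdomf_ne : domf.Nonempty) (hdomh_ne : domh.Nonempty)
    (hdomf_conv : Convex ℝ domf) (hdomh_conv : Convex ℝ domh)
    (f : X → ℝ) (h : Y → ℝ)
    (hfconv : ConvexOn ℝ domf f) (hhconv : ConvexOn ℝ domh h)
    (hflsc : LowerSemicontinuousOn f domf) (hhlsc : LowerSemicontinuousOn h domh)
    (Φ : X → Y → T → ℝ) (gradxΦ : X → Y → T → X) (gradyΦ : X → Y → T → Y)
    (Lxx Lxθ Lyx Lyy Lyθ : ℝ)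
    (hLxx : 0 ≤ Lxx) (hLxθ : 0 ≤ Lxθ) (hLyx : 0 ≤ Lyx) (hLyy : 0 ≤ Lyy) (hLyθ : 0 ≤ Lyθ)
    (hΦconvx : ∀ y ∈ domh, ∀ θ ∈ Θset, ConvexOn ℝ domf (fun x => Φ x y θ))
    (hΦconcy : ∀ x ∈ domf, ∀ θ ∈ Θset, ConcaveOn ℝ domh (fun y => Φ x y θ))
    (hgradx : ∀ x ∈ domf, ∀ y ∈ domh, ∀ θ ∈ Θset,
      HasGradientAt (fun x' => Φ x' y θ) (gradxΦ x y θ) x)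
    (hgrady : ∀ x ∈ domf, ∀ y ∈ domh, ∀ θ ∈ Θset,
      HasGradientAt (fun y' => Φ x y' θ) (gradyΦ x y θ) y)
    (hLipx : ∀ x ∈ domf, ∀ x' ∈ domf, ∀ y ∈ domh, ∀ θ ∈ Θset, ∀ θ' ∈ Θset,
      ‖gradxΦ x y θ - gradxΦ x' y θ'‖ ≤ Lxx * ‖x - x'‖ + Lxθ * ‖θ - θ'‖)
    (hLipy : ∀ x ∈ domf, ∀ x' ∈ domf, ∀ y ∈ domh, ∀ y' ∈ domh, ∀ θ ∈ Θset, ∀ θ' ∈ Θset,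
      ‖gradyΦ x y θ - gradyΦ x' y' θ'‖ ≤ Lyx * ‖x - x'‖ + Lyy * ‖y - y'‖ + Lyθ * ‖θ - θ'‖)
    (Lθ : ℝ) (hLθ : 0 ≤ Lθ)
    (hAssB : ∀ x ∈ domf, ∀ y ∈ domh, ∀ θ₁ ∈ Θset, ∀ θ₂ ∈ Θset,
      |Φ x y θ₁ - Φ x y θ₂| ≤ Lθ * ‖θ₁ - θ₂‖)
    (φX : X → ℝ) (gφX : X → X) (UX : Set X) (hUXopen : IsOpen UX) (hUXf : domf ⊆ UX)
    (hφX : ∀ x ∈ UX, HasGradientAt φX (gφX x) x)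
    (DX : X → X → ℝ)
    (hDXdef : ∀ x x', DX x x' = φX x - φX x' - ⟪gφX x', x - x'⟫)
    (hDXlb : ∀ x, ∀ x' ∈ domf, 1 / 2 * ‖x - x'‖ ^ 2 ≤ DX x x')
    (φY : Y → ℝ) (gφY : Y → Y) (UY : Set Y) (hUYopen : IsOpen UY) (hUYh : domh ⊆ UY)
    (hφY : ∀ y ∈ UY, HasGradientAt φY (gφY y) y)
    (DY : Y → Y → ℝ)
    (hDYdef : ∀ y y', DY y y' = φY y - φY y' - ⟪gφY y', y - y'⟫)
    (hDYlb : ∀ y, ∀ y' ∈ domh, 1 / 2 * ‖y - y'‖ ^ 2 ≤ DY y y')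
    (θstar : T) (hθstar : θstar ∈ Θset)
    (τs σs ηs αs βs : ℕ → ℝ)
    (hτs : ∀ k, 0 < τs k) (hσs : ∀ k, 0 < σs k) (hηs : ∀ k, 0 ≤ ηs k)
    (hαs : ∀ k, 0 < αs k) (hβs : ∀ k, 0 < βs k)
    (xx : ℕ → X) (yy : ℕ → Y) (θθ : ℕ → T)
    (hxx : ∀ k, xx k ∈ domf) (hyy : ∀ k, yy k ∈ domh) (hθθ : ∀ k, θθ k ∈ Θset)
    (hyupd : ∀ k : ℕ, ∀ y' ∈ domh,
      h (yy (k + 1))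
        - ⟪(1 + ηs k) • gradyΦ (xx k) (yy k) (θθ k)
            - ηs k • gradyΦ (xx (k - 1)) (yy (k - 1)) (θθ (k - 1)), yy (k + 1)⟫
        + 1 / σs k * DY (yy (k + 1)) (yy k)
      ≤ h y'
        - ⟪(1 + ηs k) • gradyΦ (xx k) (yy k) (θθ k)
            - ηs k • gradyΦ (xx (k - 1)) (yy (k - 1)) (θθ (k - 1)), y'⟫
        + 1 / σs k * DY y' (yy k))
    (hxupd : ∀ k : ℕ, ∀ x' ∈ domf,
      f (xx (k + 1)) + ⟪gradxΦ (xx k) (yy (k + 1)) (θθ (k + 1)), xx (k + 1)⟫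
        + 1 / τs k * DX (xx (k + 1)) (xx k)
      ≤ f x' + ⟪gradxΦ (xx k) (yy (k + 1)) (θθ (k + 1)), x'⟫ + 1 / τs k * DX x' (xx k))
    (ts : ℕ → ℝ) (htpos : ∀ k, 0 < ts k) (ht0 : ts 0 = 1)
    (htτ : ∀ k : ℕ, ts (k + 1) / τs (k + 1) ≤ ts k / τs k)
    (htσ : ∀ k : ℕ, ts (k + 1) / σs (k + 1) ≤ ts k / σs k)
    (htη : ∀ k : ℕ, ts k / ts (k + 1) = ηs (k + 1))
    :
    ∀ K : ℕ, 1 ≤ K →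
    (∀ k < K,
      (Φ (xx (k + 1)) (yy (k + 1)) (θθ (k + 1)) - Φ (xx k) (yy (k + 1)) (θθ (k + 1))
          - ⟪gradxΦ (xx k) (yy (k + 1)) (θθ (k + 1)), xx (k + 1) - xx k⟫)
        + 1 / (2 * αs (k + 1))
          * ‖gradyΦ (xx (k + 1)) (yy (k + 1)) (θθ (k + 1))
              - gradyΦ (xx k) (yy (k + 1)) (θθ (k + 1))‖ ^ 2
        + 1 / βs (k + 1)
          * ‖gradyΦ (xx k) (yy (k + 1)) (θθ k) - gradyΦ (xx k) (yy k) (θθ k)‖ ^ 2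
        - (1 / σs k - ηs k * (αs k + βs k)) * DY (yy (k + 1)) (yy k)
        - 1 / τs k * DX (xx (k + 1)) (xx k) ≤ 0) →
    1 / σs K ≥ ηs K * (αs K + βs K) →
    ∀ TK : ℝ, TK = ∑ k ∈ Finset.range K, ts k →
    ∀ xb : X, xb = TK⁻¹ • ∑ k ∈ Finset.range K, ts k • xx (k + 1) →
    ∀ yb : Y, yb = TK⁻¹ • ∑ k ∈ Finset.range K, ts k • yy (k + 1) →
    ∀ x ∈ domf, ∀ y ∈ domh,
      (f xb + Φ xb y θstar - h y) - (f x + Φ x yb θstar - h yb)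
      ≤ 1 / TK * (1 / τs 0 * DX x (xx 0) + 1 / σs 0 * DY y (yy 0))
        + 2 * Lθ / TK * ∑ k ∈ Finset.range K, ts k * ‖θθ (k + 1) - θstar‖
        + Lyθ ^ 2 / TK * ∑ k ∈ Finset.range K, ts k / βs (k + 1) * ‖θθ (k + 1) - θθ k‖ ^ 2 := by
  intro K hK hE hσK TK hTK xb hxb yb hyb x hx y hy
  set g : ℕ → Y := fun k => gradyΦ (xx k) (yy k) (θθ k) with hg
  set q : ℕ → Y := fun k => g k - g (k - 1) with hq
  set P : ℕ → ℝ := fun k =>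
    1 / (2 * αs k)
        * ‖gradyΦ (xx k) (yy k) (θθ k) - gradyΦ (xx (k - 1)) (yy k) (θθ k)‖ ^ 2
      + 1 / βs k * ‖gradyΦ (xx (k - 1)) (yy k) (θθ (k - 1)) - g (k - 1)‖ ^ 2
      + 1 / βs k * (Lyθ ^ 2 * ‖θθ k - θθ (k - 1)‖ ^ 2) with hP
  set gap : ℕ → ℝ := fun k =>
    (f (xx (k + 1)) + Φ (xx (k + 1)) y θstar - h y)
      - (f x + Φ x (yy (k + 1)) θstar - h (yy (k + 1))) with hgap
  have hyoung : ∀ k v, ⟪q k, v⟫ ≤ P k + (αs k + βs k) * (1 / 2 * ‖v‖ ^ 2) := by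
    intro k v
    have h1 := real_inner_add_add_le_young
      (gradyΦ (xx k) (yy k) (θθ k) - gradyΦ (xx (k - 1)) (yy k) (θθ k))
      (gradyΦ (xx (k - 1)) (yy k) (θθ (k - 1)) - g (k - 1))
      (gradyΦ (xx (k - 1)) (yy k) (θθ k) - gradyΦ (xx (k - 1)) (yy k) (θθ (k - 1))) v
      (hαs k) (hβs k)
    have h2 : ‖gradyΦ (xx (k - 1)) (yy k) (θθ k)
        - gradyΦ (xx (k - 1)) (yy k) (θθ (k - 1))‖ ≤ Lyθ * ‖θθ k - θθ (k - 1)‖ := by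
      simpa using hLipy _ (hxx (k - 1)) _ (hxx (k - 1)) _ (hyy k) _ (hyy k)
        _ (hθθ k) _ (hθθ (k - 1))
    have h3 := pow_le_pow_left₀ (norm_nonneg _) h2 2
    rw [mul_pow] at h3
    have h4 := mul_le_mul_of_nonneg_left h3 (one_div_pos.2 (hβs k)).le
    have h5 : q k = (gradyΦ (xx k) (yy k) (θθ k) - gradyΦ (xx (k - 1)) (yy k) (θθ k))
        + (gradyΦ (xx (k - 1)) (yy k) (θθ (k - 1)) - g (k - 1))
        + (gradyΦ (xx (k - 1)) (yy k) (θθ k) - gradyΦ (xx (k - 1)) (yy k) (θθ (k - 1))) := by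
      simp only [hq, hg]
      abel
    rw [h5]
    simp only [hP]
    linarith
  have hstep : ∀ k < K, gap k ≤ 2 * Lθ * ‖θθ (k + 1) - θstar‖
      + 1 / βs (k + 1) * (Lyθ ^ 2 * ‖θθ (k + 1) - θθ k‖ ^ 2)
      - (⟪q (k + 1), yy (k + 1) - y⟫ + P (k + 1)) + ηs k * (⟪q k, yy k - y⟫ + P k)
      + 1 / τs k * (DX x (xx k) - DX x (xx (k + 1)))
      + 1 / σs k * (DY y (yy k) - DY y (yy (k + 1))) := by
    intro k hk
    have hEk := hE k hk
    have hfx := hfconv.three_point_of_bregman_prox hDXdef (hφX _ (hUXf (hxx (k + 1))))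
      (hxx (k + 1)) hx (hxupd k)
    have hhy := hhconv.three_point_of_bregman_prox (r := 1 / σs k) (c := yy k)
      (p := -(g k + ηs k • q k)) hDYdef (hφY _ (hUYh (hyy (k + 1)))) (hyy (k + 1)) hy
      (by
        intro w hw
        have := hyupd k w hw
        have hs : (1 + ηs k) • gradyΦ (xx k) (yy k) (θθ k)
            - ηs k • gradyΦ (xx (k - 1)) (yy (k - 1)) (θθ (k - 1)) = g k + ηs k • q k := by
          simp only [hq, hg]
          module
        rw [hs] at this
        simp only [inner_neg_left]
        linarith)
    have hΦx := (hΦconvx _ (hyy (k + 1)) _ (hθθ (k + 1))).add_inner_le_of_hasGradientAt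
      (hgradx _ (hxx k) _ (hyy (k + 1)) _ (hθθ (k + 1))) (hxx k) hx
    have hΦy := (hΦconcy _ (hxx (k + 1)) _ (hθθ (k + 1))).le_add_inner_of_hasGradientAt
      (hgrady _ (hxx (k + 1)) _ (hyy (k + 1)) _ (hθθ (k + 1))) (hyy (k + 1)) hy
    have hB₁ := neg_le_of_abs_le
      (hAssB _ (hxx (k + 1)) _ hy _ (hθθ (k + 1)) _ hθstar)
    have hB₂ := le_of_abs_le (hAssB _ hx _ (hyy (k + 1)) _ (hθθ (k + 1)) _ hθstar)
    have hYoung := mul_le_mul_of_nonneg_left ((hyoung k (yy (k + 1) - yy k)).trans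
      (add_le_add_right (mul_le_mul_of_nonneg_left (hDYlb (yy (k + 1)) _ (hyy k))
        (add_pos (hαs k) (hβs k)).le) _)) (hηs k)
    have hg' : g (k + 1) = g k + q (k + 1) := by simp [hq]
    change Φ (xx (k + 1)) y (θθ (k + 1)) ≤ Φ (xx (k + 1)) (yy (k + 1)) (θθ (k + 1))
      + ⟪g (k + 1), y - yy (k + 1)⟫ at hΦy
    rw [hg'] at hΦy
    have hPk : P (k + 1) = 1 / (2 * αs (k + 1))
          * ‖gradyΦ (xx (k + 1)) (yy (k + 1)) (θθ (k + 1))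
              - gradyΦ (xx k) (yy (k + 1)) (θθ (k + 1))‖ ^ 2
        + 1 / βs (k + 1)
          * ‖gradyΦ (xx k) (yy (k + 1)) (θθ k) - gradyΦ (xx k) (yy k) (θθ k)‖ ^ 2
        + 1 / βs (k + 1) * (Lyθ ^ 2 * ‖θθ (k + 1) - θθ k‖ ^ 2) := rfl
    simp only [inner_add_left, inner_neg_left, inner_sub_right, real_inner_smul_left]
      at hfx hhy hΦx hΦy hYoung hEk ⊢
    simp only [hgap]
    rw [hPk]
    linarith
  have htη' : ∀ k, ts (k + 1) * ηs (k + 1) = ts k := fun k => by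
    rw [← htη k, mul_div_cancel₀ _ (htpos (k + 1)).ne']
  have hDX : ∀ k, 0 ≤ DX x (xx k) := fun k =>
    (by positivity : (0 : ℝ) ≤ 1 / 2 * ‖x - xx k‖ ^ 2).trans (hDXlb x _ (hxx k))
  have hDY : ∀ k, 0 ≤ DY y (yy k) := fun k =>
    (by positivity : (0 : ℝ) ≤ 1 / 2 * ‖y - yy k‖ ^ 2).trans (hDYlb y _ (hyy k))
  have hsum : ∀ n ≤ K, ∑ k ∈ Finset.range n, ts k * gap k
      ≤ 1 / τs 0 * DX x (xx 0) + 1 / σs 0 * DY y (yy 0)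
        + 2 * Lθ * ∑ k ∈ Finset.range n, ts k * ‖θθ (k + 1) - θstar‖
        + Lyθ ^ 2 * ∑ k ∈ Finset.range n, ts k / βs (k + 1) * ‖θθ (k + 1) - θθ k‖ ^ 2
        - ts n * ηs n * (⟪q n, yy n - y⟫ + P n)
        - ts n / τs n * DX x (xx n) - ts n / σs n * DY y (yy n) := by
    intro n
    induction n with
    | zero =>
      intro _
      simp [hq, hP, hg, ht0]
    | succ n ih =>
      intro hn
      have h1 := ih (Nat.le_of_succ_le hn)
      have h2 := mul_le_mul_of_nonneg_left (hstep n hn) (htpos n).le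
      have h3 := mul_le_mul_of_nonneg_right (htτ n) (hDX (n + 1))
      have h4 := mul_le_mul_of_nonneg_right (htσ n) (hDY (n + 1))
      simp only [Finset.sum_range_succ]
      rw [htη' n]
      have h5 : ts n * (1 / τs n * (DX x (xx n) - DX x (xx (n + 1))))
        = ts n / τs n * DX x (xx n) - ts n / τs n * DX x (xx (n + 1)) := by ring
      have h6 : ts n * (1 / σs n * (DY y (yy n) - DY y (yy (n + 1))))
        = ts n / σs n * DY y (yy n) - ts n / σs n * DY y (yy (n + 1)) := by ring
      have h7 : ts n * (1 / βs (n + 1) * (Lyθ ^ 2 * ‖θθ (n + 1) - θθ n‖ ^ 2))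
        = Lyθ ^ 2 * (ts n / βs (n + 1) * ‖θθ (n + 1) - θθ n‖ ^ 2) := by ring
      simp only [mul_add, mul_sub] at h1 h2 h5 h6 h7 ⊢
      linarith
  have hfinal : ∑ k ∈ Finset.range K, ts k * gap k
      ≤ 1 / τs 0 * DX x (xx 0) + 1 / σs 0 * DY y (yy 0)
        + 2 * Lθ * ∑ k ∈ Finset.range K, ts k * ‖θθ (k + 1) - θstar‖
        + Lyθ ^ 2 * ∑ k ∈ Finset.range K, ts k / βs (k + 1) * ‖θθ (k + 1) - θθ k‖ ^ 2 := by
    have h1 := hsum K le_rfl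
    have h2 := (hyoung K (y - yy K)).trans
      (add_le_add_right (mul_le_mul_of_nonneg_left (hDYlb y _ (hyy K))
        (add_pos (hαs K) (hβs K)).le) _)
    have h3 : ⟪q K, yy K - y⟫ = -⟪q K, y - yy K⟫ := by rw [← inner_neg_right, neg_sub]
    rw [h3] at h1
    have h4 := mul_le_mul_of_nonneg_left h2 (mul_nonneg (htpos K).le (hηs K))
    have h5 := mul_le_mul_of_nonneg_left (mul_le_mul_of_nonneg_right hσK (hDY K)) (htpos K).le
    have h6 : 0 ≤ ts K / τs K * DX x (xx K) :=
      mul_nonneg (div_pos (htpos K) (hτs K)).le (hDX K)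
    have h7 : ts K * (1 / σs K * DY y (yy K)) = ts K / σs K * DY y (yy K) := by ring
    have h8 : ts K * (ηs K * (αs K + βs K) * DY y (yy K))
      = ts K * ηs K * ((αs K + βs K) * DY y (yy K)) := by ring
    simp only [mul_add, mul_neg] at h1 h4 h5 h8
    linarith
  have hTpos : 0 < ∑ k ∈ Finset.range K, ts k :=
    Finset.sum_pos (fun k _ => htpos k) (Finset.nonempty_range_iff.2 (by lia))
  have hw : ∀ k ∈ Finset.range K, 0 ≤ ts k := fun k _ => (htpos k).le
  have hJx := (hfconv.add (hΦconvx y hy θstar hθstar)).mul_map_average_le hw hTpos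
    (p := fun k => xx (k + 1)) (fun k _ => hxx (k + 1))
  have hJy := (hhconv.sub (hΦconcy x hx θstar hθstar)).mul_map_average_le hw hTpos
    (p := fun k => yy (k + 1)) (fun k _ => hyy (k + 1))
  have hTK' : 0 < TK := hTK ▸ hTpos
  rw [← hTK, ← hxb] at hJx
  rw [← hTK, ← hyb] at hJy
  have hgapsum : ∑ k ∈ Finset.range K, ts k * gap k
      = ∑ k ∈ Finset.range K, ts k * (f + fun x => Φ x y θstar) (xx (k + 1))
        + ∑ k ∈ Finset.range K, ts k * (h - fun y => Φ x y θstar) (yy (k + 1))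
        - TK * (h y + f x) := by
    rw [hTK, Finset.sum_mul, ← Finset.sum_add_distrib, ← Finset.sum_sub_distrib]
    refine Finset.sum_congr rfl fun k _ => ?_
    simp only [hgap, Pi.add_apply, Pi.sub_apply]
    ring
  simp only [Pi.add_apply, Pi.sub_apply] at hJx hJy hgapsum
  have hmul : ((f xb + Φ xb y θstar - h y) - (f x + Φ x yb θstar - h yb)) * TK
      ≤ 1 / τs 0 * DX x (xx 0) + 1 / σs 0 * DY y (yy 0)
        + 2 * Lθ * ∑ k ∈ Finset.range K, ts k * ‖θθ (k + 1) - θstar‖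
        + Lyθ ^ 2 * ∑ k ∈ Finset.range K, ts k / βs (k + 1) * ‖θθ (k + 1) - θθ k‖ ^ 2 := by
    linarith
  refine ((le_div_iff₀ hTK').2 hmul).trans_eq ?_
  ring
end

section
/- In the setting of the Learning-aware gap bound theorem (Assumptions A and B, Learning-aware iterates, conditions (i)–(iii)), suppose additionally that t_k ≤ 1 and β_{k+1} ≥ β > 0 for all 0 ≤ k ≤ K−1, that D_X(x, x₀) ≤ R_x for all x ∈ dom f and D_Y(y, y₀) ≤ R_y for all y ∈ dom h for finite constants R_x, R_y, and that there is C_θ > 0 with ‖θ_k − θ*‖ ≤ √C_θ/(k+1) for all k ≥ 0. Then for every x ∈ dom f, y ∈ dom h, and K ≥ 1: L(x̄_K, y; θ*) − L(x, ȳ_K; θ*) ≤ (1/T_K)[(1/τ₀)R_x + (1/σ₀)R_y] + (2 L_θ √C_θ / T_K)·(1 + log K) + (4 C_θ (L_yθ)² π²)/(6 T_K β). -/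
open RealInnerProductSpace

/-- First-order optimality for the sum of a convex function and a differentiable one. -/
lemma ConvexOn.le_add_inner_of_isMin_add {E : Type*} [NormedAddCommGroup E]
    [InnerProductSpace ℝ E] [CompleteSpace E] {S : Set E} {g ψ : E → ℝ} {v z w : E}
    (hg : ConvexOn ℝ S g) (hz : z ∈ S) (hw : w ∈ S) (hψ : HasGradientAt ψ v z)
    (hmin : ∀ u ∈ S, g z + ψ z ≤ g u + ψ u) : g z ≤ g w + ⟪v, w - z⟫ := by
  have hd := (hψ.hasFDerivAt.hasLineDerivAt (w - z)).tendsto_slope_zero_right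
  simp only [InnerProductSpace.toDual_apply_apply, smul_eq_mul] at hd
  suffices g z - g w ≤ ⟪v, w - z⟫ by linarith
  refine ge_of_tendsto hd ?_
  filter_upwards [Ioo_mem_nhdsGT (zero_lt_one : (0 : ℝ) < 1)] with t ht
  have hcomb : (1 - t) • z + t • w = z + t • (w - z) := by module
  have h₁ := hg.2 hz hw (sub_nonneg.2 ht.2.le) ht.1.le (by ring)
  have h₂ := hmin _ (hg.1 hz hw (sub_nonneg.2 ht.2.le) ht.1.le (by ring))
  rw [hcomb] at h₁ h₂
  simp only [smul_eq_mul] at h₁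
  rw [inv_mul_eq_div, le_div_iff₀ ht.1]
  linarith

lemma ConvexOn.add_inner_le_of_hasGradientAt_s7 {E : Type*} [NormedAddCommGroup E]
    [InnerProductSpace ℝ E] [CompleteSpace E] {S : Set E} {g : E → ℝ} {v z w : E}
    (hg : ConvexOn ℝ S g) (hz : z ∈ S) (hw : w ∈ S) (hv : HasGradientAt g v z) :
    g z + ⟪v, w - z⟫ ≤ g w := by
  have hneg : HasGradientAt (fun u => -g u) (-v) z := by
    rw [hasGradientAt_iff_hasFDerivAt, map_neg]
    exact hv.hasFDerivAt.neg
  have := hg.le_add_inner_of_isMin_add hz hw hneg (fun u _ => by simp)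
  rw [inner_neg_left] at this
  linarith

lemma ConcaveOn.le_add_inner_of_hasGradientAt_s7 {E : Type*} [NormedAddCommGroup E]
    [InnerProductSpace ℝ E] [CompleteSpace E] {S : Set E} {g : E → ℝ} {v z w : E}
    (hg : ConcaveOn ℝ S g) (hz : z ∈ S) (hw : w ∈ S) (hv : HasGradientAt g v z) :
    g w ≤ g z + ⟪v, w - z⟫ := by
  have hneg : HasGradientAt (-g) (-v) z := by
    rw [hasGradientAt_iff_hasFDerivAt, map_neg]
    exact hv.hasFDerivAt.neg
  have := hg.neg.add_inner_le_of_hasGradientAt_s7 hz hw hneg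
  rw [inner_neg_left] at this
  simp only [Pi.neg_apply] at this
  linarith

/-- Three-point inequality for a Bregman proximal step with linear term `p`. -/
lemma ConvexOn.bregman_three_point {E : Type*} [NormedAddCommGroup E]
    [InnerProductSpace ℝ E] [CompleteSpace E] {S : Set E} {g φ : E → ℝ} {gφ : E → E}
    {D : E → E → ℝ} (hD : ∀ x x', D x x' = φ x - φ x' - ⟪gφ x', x - x'⟫)
    {p z z₀ w : E} {c : ℝ} (hg : ConvexOn ℝ S g) (hz : z ∈ S) (hw : w ∈ S)
    (hφ : HasGradientAt φ (gφ z) z)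
    (hmin : ∀ u ∈ S, g z + ⟪p, z⟫ + c * D z z₀ ≤ g u + ⟪p, u⟫ + c * D u z₀) :
    g z + ⟪p, z - w⟫ ≤ g w + c * (D w z₀ - D w z - D z z₀) := by
  have hgrad : HasGradientAt (fun u => ⟪p, u⟫ + c * (φ u - φ z₀ - ⟪gφ z₀, u - z₀⟫))
      (p + c • (gφ z - gφ z₀)) z := by
    rw [hasGradientAt_iff_hasFDerivAt]
    have h₁ : HasFDerivAt (fun u => ⟪p, u⟫) (InnerProductSpace.toDual ℝ E p) z :=
      (InnerProductSpace.toDual ℝ E p).hasFDerivAt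
    have h₂ : HasFDerivAt (fun u => ⟪gφ z₀, u - z₀⟫)
        (InnerProductSpace.toDual ℝ E (gφ z₀)) z := by
      have := ((InnerProductSpace.toDual ℝ E (gφ z₀)).hasFDerivAt (x := z)).sub_const
        ⟪gφ z₀, z₀⟫
      refine this.congr_of_eventuallyEq (Filter.Eventually.of_forall fun u => ?_)
      simp [inner_sub_right]
    have h₃ := h₁.add (((hφ.hasFDerivAt.sub_const (φ z₀)).sub h₂).const_mul c)
    refine h₃.congr_fderiv ?_
    simp
  have key := hg.le_add_inner_of_isMin_add hz hw hgrad (fun u hu => by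
    have := hmin u hu
    rw [hD, hD u] at this
    linarith)
  rw [hD w, hD w, hD z]
  simp only [inner_add_left, inner_smul_left, inner_sub_left, inner_sub_right,
    RCLike.conj_to_real] at key ⊢
  linarith

lemma inner_add_add_le_young {E : Type*} [NormedAddCommGroup E] [InnerProductSpace ℝ E]
    (a b c d : E) {α β : ℝ} (hα : 0 < α) (hβ : 0 < β) :
    ⟪a + b + c, d⟫ ≤ 1 / (2 * α) * ‖a‖ ^ 2 + 1 / β * ‖c‖ ^ 2 + 1 / β * ‖b‖ ^ 2
      + (α + β) * (1 / 2 * ‖d‖ ^ 2) := by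
  have young : ∀ (u : E) (γ : ℝ), 0 < γ →
      ⟪u, d⟫ ≤ 1 / (2 * γ) * ‖u‖ ^ 2 + γ * (1 / 2 * ‖d‖ ^ 2) := by
    intro u γ hγ
    have h₁ := real_inner_le_norm u d
    have h₂ : 1 / (2 * γ) * ‖u‖ ^ 2 + γ * (1 / 2 * ‖d‖ ^ 2) - ‖u‖ * ‖d‖
        = 1 / (2 * γ) * (‖u‖ - γ * ‖d‖) ^ 2 := by
      field_simp
      ring
    have h₃ : 0 ≤ 1 / (2 * γ) * (‖u‖ - γ * ‖d‖) ^ 2 := by positivity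
    linarith
  have ha := young a α hα
  have hbc := young (b + c) β hβ
  have hsq : ‖b + c‖ ^ 2 ≤ 2 * (‖b‖ ^ 2 + ‖c‖ ^ 2) := by
    nlinarith [parallelogram_law_with_norm ℝ b c, sq_nonneg ‖b - c‖]
  have hsq' : 1 / (2 * β) * ‖b + c‖ ^ 2 ≤ 1 / (2 * β) * (2 * (‖b‖ ^ 2 + ‖c‖ ^ 2)) := by
    gcongr
  have heq : 1 / (2 * β) * (2 * (‖b‖ ^ 2 + ‖c‖ ^ 2)) = 1 / β * ‖c‖ ^ 2 + 1 / β * ‖b‖ ^ 2 := by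
    field_simp
    ring
  rw [add_assoc a, inner_add_left]
  linarith

lemma sum_range_one_div_add_one_sq_le (K : ℕ) :
    ∑ k ∈ Finset.range K, 1 / ((k : ℝ) + 1) ^ 2 ≤ Real.pi ^ 2 / 6 := by
  have h := sum_le_hasSum (Finset.range (K + 1)) (fun i _ => by positivity) hasSum_zeta_two
  rw [Finset.sum_range_succ'] at h
  simpa using h

lemma sum_range_one_div_add_one_le (K : ℕ) :
    ∑ k ∈ Finset.range K, 1 / ((k : ℝ) + 1) ≤ 1 + Real.log K := by
  have h := harmonic_le_one_add_log K
  simpa [harmonic] using h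

/-- Telescoping of the weighted one-step estimates: `dx`, `dy` are distances to the comparison
point, `ex`, `ey` distances between consecutive iterates, `Q` and `q` the extrapolation terms. -/
lemma weighted_gap_sum_le {t τ σ η ω G dx dy ex ey Λ Q q P B : ℕ → ℝ} {K : ℕ}
    (ht : ∀ k, 0 < t k) (ht0 : t 0 = 1)
    (htτ : ∀ k, t (k + 1) / τ (k + 1) ≤ t k / τ k)
    (htσ : ∀ k, t (k + 1) / σ (k + 1) ≤ t k / σ k)
    (htη : ∀ k, t k / t (k + 1) = η (k + 1)) (hη : ∀ k, 0 ≤ η k) (hτ : ∀ k, 0 < τ k)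
    (hdx : ∀ k, 0 ≤ dx k) (hdy : ∀ k, 0 ≤ dy k)
    (hQ0 : Q 0 = 0) (hP0 : P 0 = 0) (hB0 : B 0 = 0)
    (hstep : ∀ k, G k ≤ Λ k + 1 / τ k * (dx k - dx (k + 1) - ex k)
      + 1 / σ k * (dy k - dy (k + 1) - ey k) + Q (k + 1) - η k * Q k + η k * q k)
    (hq : ∀ k, q k ≤ P k + B k + ω k * ey k)
    (hQ : Q K ≤ P K + B K + ω K * dy K)
    (hE : ∀ k < K, Λ k + P (k + 1) - (1 / σ k - η k * ω k) * ey k - 1 / τ k * ex k ≤ 0)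
    (hK : η K * ω K ≤ 1 / σ K) :
    ∑ k ∈ Finset.range K, t k * G k
      ≤ 1 / τ 0 * dx 0 + 1 / σ 0 * dy 0 + ∑ k ∈ Finset.range K, t k * B (k + 1) := by
  have hmul : ∀ k, t (k + 1) * η (k + 1) = t k := fun k => by
    rw [← htη, mul_div_cancel₀ _ (ht _).ne']
  have main : ∀ n ≤ K, ∑ k ∈ Finset.range n, t k * G k + t n * η n * (P n + B n)
      ≤ 1 / τ 0 * dx 0 + 1 / σ 0 * dy 0 - t n / τ n * dx n - t n / σ n * dy n
        + t n * η n * Q n + ∑ k ∈ Finset.range n, t k * B (k + 1) := by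
    intro n
    induction n with
    | zero => intro _; simp [ht0, hQ0, hP0, hB0]
    | succ n ih =>
      intro hn
      have ih := ih (by omega)
      rw [Finset.sum_range_succ, Finset.sum_range_succ, hmul]
      have h₁ := mul_le_mul_of_nonneg_left (hstep n) (ht n).le
      have h₂ := mul_le_mul_of_nonneg_left (hE n (by omega)) (ht n).le
      have h₃ := mul_le_mul_of_nonneg_left (hq n) (mul_nonneg (ht n).le (hη n))
      have h₄ := mul_le_mul_of_nonneg_right (htτ n) (hdx (n + 1))
      have h₅ := mul_le_mul_of_nonneg_right (htσ n) (hdy (n + 1))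
      simp only [div_eq_mul_inv] at *
      linarith
  have hend := main K le_rfl
  have h₁ := mul_le_mul_of_nonneg_left hQ (mul_nonneg (ht K).le (hη K))
  have h₂ := mul_le_mul_of_nonneg_left hK (mul_nonneg (ht K).le (hdy K))
  have h₃ : 0 ≤ t K / τ K * dx K := mul_nonneg (div_pos (ht K) (hτ K)).le (hdx K)
  simp only [div_eq_mul_inv] at *
  linarith

theorem stmt_7
    {X : Type*} [NormedAddCommGroup X] [InnerProductSpace ℝ X] [FiniteDimensional ℝ X]
    {Y : Type*} [NormedAddCommGroup Y] [InnerProductSpace ℝ Y] [FiniteDimensional ℝ Y]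
    {T : Type*} [NormedAddCommGroup T] [InnerProductSpace ℝ T] [FiniteDimensional ℝ T]
    (domf : Set X) (domh : Set Y) (Θset : Set T)
    (hdomf_ne : domf.Nonempty) (hdomh_ne : domh.Nonempty)
    (hdomf_conv : Convex ℝ domf) (hdomh_conv : Convex ℝ domh)
    (f : X → ℝ) (h : Y → ℝ)
    (hfconv : ConvexOn ℝ domf f) (hhconv : ConvexOn ℝ domh h)
    (hflsc : LowerSemicontinuousOn f domf) (hhlsc : LowerSemicontinuousOn h domh)
    (Φ : X → Y → T → ℝ) (gradxΦ : X → Y → T → X) (gradyΦ : X → Y → T → Y)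
    (Lxx Lxθ Lyx Lyy Lyθ : ℝ)
    (hLxx : 0 ≤ Lxx) (hLxθ : 0 ≤ Lxθ) (hLyx : 0 ≤ Lyx) (hLyy : 0 ≤ Lyy) (hLyθ : 0 ≤ Lyθ)
    (hΦconvx : ∀ y ∈ domh, ∀ θ ∈ Θset, ConvexOn ℝ domf (fun x => Φ x y θ))
    (hΦconcy : ∀ x ∈ domf, ∀ θ ∈ Θset, ConcaveOn ℝ domh (fun y => Φ x y θ))
    (hgradx : ∀ x ∈ domf, ∀ y ∈ domh, ∀ θ ∈ Θset,
      HasGradientAt (fun x' => Φ x' y θ) (gradxΦ x y θ) x)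
    (hgrady : ∀ x ∈ domf, ∀ y ∈ domh, ∀ θ ∈ Θset,
      HasGradientAt (fun y' => Φ x y' θ) (gradyΦ x y θ) y)
    (hLipx : ∀ x ∈ domf, ∀ x' ∈ domf, ∀ y ∈ domh, ∀ θ ∈ Θset, ∀ θ' ∈ Θset,
      ‖gradxΦ x y θ - gradxΦ x' y θ'‖ ≤ Lxx * ‖x - x'‖ + Lxθ * ‖θ - θ'‖)
    (hLipy : ∀ x ∈ domf, ∀ x' ∈ domf, ∀ y ∈ domh, ∀ y' ∈ domh, ∀ θ ∈ Θset, ∀ θ' ∈ Θset,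
      ‖gradyΦ x y θ - gradyΦ x' y' θ'‖ ≤ Lyx * ‖x - x'‖ + Lyy * ‖y - y'‖ + Lyθ * ‖θ - θ'‖)
    (Lθ : ℝ) (hLθ : 0 ≤ Lθ)
    (hAssB : ∀ x ∈ domf, ∀ y ∈ domh, ∀ θ₁ ∈ Θset, ∀ θ₂ ∈ Θset,
      |Φ x y θ₁ - Φ x y θ₂| ≤ Lθ * ‖θ₁ - θ₂‖)
    (φX : X → ℝ) (gφX : X → X) (UX : Set X) (hUXopen : IsOpen UX) (hUXf : domf ⊆ UX)
    (hφX : ∀ x ∈ UX, HasGradientAt φX (gφX x) x)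
    (DX : X → X → ℝ)
    (hDXdef : ∀ x x', DX x x' = φX x - φX x' - ⟪gφX x', x - x'⟫)
    (hDXlb : ∀ x, ∀ x' ∈ domf, 1 / 2 * ‖x - x'‖ ^ 2 ≤ DX x x')
    (φY : Y → ℝ) (gφY : Y → Y) (UY : Set Y) (hUYopen : IsOpen UY) (hUYh : domh ⊆ UY)
    (hφY : ∀ y ∈ UY, HasGradientAt φY (gφY y) y)
    (DY : Y → Y → ℝ)
    (hDYdef : ∀ y y', DY y y' = φY y - φY y' - ⟪gφY y', y - y'⟫)
    (hDYlb : ∀ y, ∀ y' ∈ domh, 1 / 2 * ‖y - y'‖ ^ 2 ≤ DY y y')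
    (θstar : T) (hθstar : θstar ∈ Θset)
    (τs σs ηs αs βs : ℕ → ℝ)
    (hτs : ∀ k, 0 < τs k) (hσs : ∀ k, 0 < σs k) (hηs : ∀ k, 0 ≤ ηs k)
    (hαs : ∀ k, 0 < αs k) (hβs : ∀ k, 0 < βs k)
    (xx : ℕ → X) (yy : ℕ → Y) (θθ : ℕ → T)
    (hxx : ∀ k, xx k ∈ domf) (hyy : ∀ k, yy k ∈ domh) (hθθ : ∀ k, θθ k ∈ Θset)
    (hyupd : ∀ k : ℕ, ∀ y' ∈ domh,
      h (yy (k + 1))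
        - ⟪(1 + ηs k) • gradyΦ (xx k) (yy k) (θθ k)
            - ηs k • gradyΦ (xx (k - 1)) (yy (k - 1)) (θθ (k - 1)), yy (k + 1)⟫
        + 1 / σs k * DY (yy (k + 1)) (yy k)
      ≤ h y'
        - ⟪(1 + ηs k) • gradyΦ (xx k) (yy k) (θθ k)
            - ηs k • gradyΦ (xx (k - 1)) (yy (k - 1)) (θθ (k - 1)), y'⟫
        + 1 / σs k * DY y' (yy k))
    (hxupd : ∀ k : ℕ, ∀ x' ∈ domf,
      f (xx (k + 1)) + ⟪gradxΦ (xx k) (yy (k + 1)) (θθ (k + 1)), xx (k + 1)⟫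
        + 1 / τs k * DX (xx (k + 1)) (xx k)
      ≤ f x' + ⟪gradxΦ (xx k) (yy (k + 1)) (θθ (k + 1)), x'⟫ + 1 / τs k * DX x' (xx k))
    (ts : ℕ → ℝ) (htpos : ∀ k, 0 < ts k) (ht0 : ts 0 = 1)
    (htτ : ∀ k : ℕ, ts (k + 1) / τs (k + 1) ≤ ts k / τs k)
    (htσ : ∀ k : ℕ, ts (k + 1) / σs (k + 1) ≤ ts k / σs k)
    (htη : ∀ k : ℕ, ts k / ts (k + 1) = ηs (k + 1))
    (β : ℝ) (hβpos : 0 < β)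
    (Rx Ry : ℝ)
    (hRx : ∀ x ∈ domf, DX x (xx 0) ≤ Rx)
    (hRy : ∀ y ∈ domh, DY y (yy 0) ≤ Ry)
    (Cθ : ℝ) (hCθ : 0 < Cθ)
    (hθrate : ∀ k : ℕ, ‖θθ k - θstar‖ ≤ Real.sqrt Cθ / ((k : ℝ) + 1)) :
    ∀ K : ℕ, 1 ≤ K →
    (∀ k < K,
      (Φ (xx (k + 1)) (yy (k + 1)) (θθ (k + 1)) - Φ (xx k) (yy (k + 1)) (θθ (k + 1))
          - ⟪gradxΦ (xx k) (yy (k + 1)) (θθ (k + 1)), xx (k + 1) - xx k⟫)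
        + 1 / (2 * αs (k + 1))
          * ‖gradyΦ (xx (k + 1)) (yy (k + 1)) (θθ (k + 1))
              - gradyΦ (xx k) (yy (k + 1)) (θθ (k + 1))‖ ^ 2
        + 1 / βs (k + 1)
          * ‖gradyΦ (xx k) (yy (k + 1)) (θθ k) - gradyΦ (xx k) (yy k) (θθ k)‖ ^ 2
        - (1 / σs k - ηs k * (αs k + βs k)) * DY (yy (k + 1)) (yy k)
        - 1 / τs k * DX (xx (k + 1)) (xx k) ≤ 0) →
    1 / σs K ≥ ηs K * (αs K + βs K) →
    (∀ k < K, ts k ≤ 1) →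
    (∀ k < K, β ≤ βs (k + 1)) →
    ∀ TK : ℝ, TK = ∑ k ∈ Finset.range K, ts k →
    ∀ xb : X, xb = TK⁻¹ • ∑ k ∈ Finset.range K, ts k • xx (k + 1) →
    ∀ yb : Y, yb = TK⁻¹ • ∑ k ∈ Finset.range K, ts k • yy (k + 1) →
    ∀ x ∈ domf, ∀ y ∈ domh,
      (f xb + Φ xb y θstar - h y) - (f x + Φ x yb θstar - h yb)
      ≤ 1 / TK * (1 / τs 0 * Rx + 1 / σs 0 * Ry)
        + 2 * Lθ * Real.sqrt Cθ / TK * (1 + Real.log (K : ℝ))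
        + 4 * Cθ * Lyθ ^ 2 * Real.pi ^ 2 / (6 * TK * β) := by
  intro K hK1 hE hKσ ht1 hββ TK hTK xb hxb yb hyb x hx y hy
  have hTKpos : 0 < TK := by
    rw [hTK]
    exact Finset.sum_pos (fun k _ => htpos k) (Finset.nonempty_range_iff.2 (by omega))
  have hDXnn : ∀ u, ∀ v ∈ domf, 0 ≤ DX u v := fun u v hv =>
    le_trans (by positivity) (hDXlb u v hv)
  have hDYnn : ∀ u, ∀ v ∈ domh, 0 ≤ DY u v := fun u v hv =>
    le_trans (by positivity) (hDYlb u v hv)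
  let a : ℕ → Y := fun k =>
    gradyΦ (xx k) (yy k) (θθ k) - gradyΦ (xx (k - 1)) (yy k) (θθ k)
  let b : ℕ → Y := fun k =>
    gradyΦ (xx (k - 1)) (yy k) (θθ k) - gradyΦ (xx (k - 1)) (yy k) (θθ (k - 1))
  let c : ℕ → Y := fun k =>
    gradyΦ (xx (k - 1)) (yy k) (θθ (k - 1)) - gradyΦ (xx (k - 1)) (yy (k - 1)) (θθ (k - 1))
  have habc : ∀ k, a k + b k + c k = gradyΦ (xx k) (yy k) (θθ k)
      - gradyΦ (xx (k - 1)) (yy (k - 1)) (θθ (k - 1)) := fun k => by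
    simp only [a, b, c]; abel
  have hyoung : ∀ k, ∀ u, ⟪a k + b k + c k, u - yy k⟫
      ≤ (1 / (2 * αs k) * ‖a k‖ ^ 2 + 1 / βs k * ‖c k‖ ^ 2) + 1 / βs k * ‖b k‖ ^ 2
        + (αs k + βs k) * DY u (yy k) := fun k u => by
    have h₁ := inner_add_add_le_young (a k) (b k) (c k) (u - yy k) (hαs k) (hβs k)
    have h₂ := mul_le_mul_of_nonneg_left (hDYlb u (yy k) (hyy k))
      (add_pos (hαs k) (hβs k)).le
    linarith
  have hsum := weighted_gap_sum_le (K := K) (t := ts) (τ := τs) (σ := σs) (η := ηs)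
    (ω := fun k => αs k + βs k)
    (G := fun k => (f (xx (k + 1)) + Φ (xx (k + 1)) y (θθ (k + 1)) - h y)
      - (f x + Φ x (yy (k + 1)) (θθ (k + 1)) - h (yy (k + 1))))
    (dx := fun k => DX x (xx k)) (dy := fun k => DY y (yy k))
    (ex := fun k => DX (xx (k + 1)) (xx k)) (ey := fun k => DY (yy (k + 1)) (yy k))
    (Λ := fun k => Φ (xx (k + 1)) (yy (k + 1)) (θθ (k + 1))
      - Φ (xx k) (yy (k + 1)) (θθ (k + 1))
      - ⟪gradxΦ (xx k) (yy (k + 1)) (θθ (k + 1)), xx (k + 1) - xx k⟫)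
    (Q := fun k => ⟪a k + b k + c k, y - yy k⟫)
    (q := fun k => ⟪a k + b k + c k, yy (k + 1) - yy k⟫)
    (P := fun k => 1 / (2 * αs k) * ‖a k‖ ^ 2 + 1 / βs k * ‖c k‖ ^ 2)
    (B := fun k => 1 / βs k * ‖b k‖ ^ 2)
    htpos ht0 htτ htσ htη hηs hτs (fun k => hDXnn _ _ (hxx k)) (fun k => hDYnn _ _ (hyy k))
    (by simp [a, b, c]) (by simp [a, c]) (by simp [b])
    (by
      intro k
      have hX := hfconv.bregman_three_point hDXdef (hxx (k + 1)) hx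
        (hφX _ (hUXf (hxx (k + 1)))) (hxupd k)
      have hY := hhconv.bregman_three_point hDYdef (hyy (k + 1)) hy
        (p := -((1 + ηs k) • gradyΦ (xx k) (yy k) (θθ k)
          - ηs k • gradyΦ (xx (k - 1)) (yy (k - 1)) (θθ (k - 1))))
        (hφY _ (hUYh (hyy (k + 1))))
        (fun u hu => by simpa only [inner_neg_left, ← sub_eq_add_neg] using hyupd k u hu)
      have hcx := (hΦconvx _ (hyy (k + 1)) _ (hθθ (k + 1))).add_inner_le_of_hasGradientAt_s7
        (hxx k) hx (hgradx _ (hxx k) _ (hyy (k + 1)) _ (hθθ (k + 1)))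
      have hcy := (hΦconcy _ (hxx (k + 1)) _ (hθθ (k + 1))).le_add_inner_of_hasGradientAt_s7
        (hyy (k + 1)) hy (hgrady _ (hxx (k + 1)) _ (hyy (k + 1)) _ (hθθ (k + 1)))
      rw [habc, habc]
      simp only [Nat.add_sub_cancel, inner_neg_left, inner_sub_left, inner_sub_right,
        inner_smul_left, RCLike.conj_to_real] at hX hY hcx hcy ⊢
      linarith)
    (fun k => hyoung k _) (hyoung K y)
    (fun k hk => by
      have := hE k hk
      simp only [a, c, Nat.add_sub_cancel]
      linarith)
    hKσ
  have hθrate' : ∀ k : ℕ, ‖θθ (k + 1) - θstar‖ ≤ Real.sqrt Cθ / ((k : ℝ) + 1) := fun k => by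
    refine (hθrate (k + 1)).trans ?_
    push_cast
    gcongr
    linarith
  have hbsum : ∑ k ∈ Finset.range K, ts k * (1 / βs (k + 1) * ‖b (k + 1)‖ ^ 2)
      ≤ 4 * Cθ * Lyθ ^ 2 / β * (Real.pi ^ 2 / 6) := by
    calc _ ≤ ∑ k ∈ Finset.range K, 4 * Cθ * Lyθ ^ 2 / β * (1 / ((k : ℝ) + 1) ^ 2) := by
          refine Finset.sum_le_sum fun k hk => ?_
          have hk := Finset.mem_range.1 hk
          have hθ : ‖θθ (k + 1) - θθ k‖ ≤ 2 * (Real.sqrt Cθ / ((k : ℝ) + 1)) := by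
            have := norm_sub_le_norm_sub_add_norm_sub (θθ (k + 1)) θstar (θθ k)
            have h' := hθrate k
            rw [norm_sub_rev] at h'
            linarith [hθrate' k]
          have hb : ‖b (k + 1)‖ ≤ Lyθ * (2 * (Real.sqrt Cθ / ((k : ℝ) + 1))) := by
            have := hLipy _ (hxx k) _ (hxx k) _ (hyy (k + 1)) _ (hyy (k + 1)) _ (hθθ (k + 1))
              _ (hθθ k)
            simp only [sub_self, norm_zero, mul_zero, zero_add] at this
            exact this.trans (by gcongr)
          calc ts k * (1 / βs (k + 1) * ‖b (k + 1)‖ ^ 2)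
              ≤ 1 * (1 / β * (Lyθ * (2 * (Real.sqrt Cθ / ((k : ℝ) + 1)))) ^ 2) := by
                have := hβs (k + 1)
                gcongr
                exacts [ht1 k hk, hββ k hk]
            _ = _ := by
                rw [mul_pow, mul_pow, div_pow, Real.sq_sqrt hCθ.le]
                field_simp
                ring
      _ ≤ _ := by
          rw [← Finset.mul_sum]
          exact mul_le_mul_of_nonneg_left (sum_range_one_div_add_one_sq_le K) (by positivity)
  have hbias : ∑ k ∈ Finset.range K, ts k
        * ((f (xx (k + 1)) + Φ (xx (k + 1)) y θstar - h y)
          - (f x + Φ x (yy (k + 1)) θstar - h (yy (k + 1))))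
      ≤ ∑ k ∈ Finset.range K, ts k
        * ((f (xx (k + 1)) + Φ (xx (k + 1)) y (θθ (k + 1)) - h y)
          - (f x + Φ x (yy (k + 1)) (θθ (k + 1)) - h (yy (k + 1))))
        + 2 * Lθ * Real.sqrt Cθ * (1 + Real.log K) := by
    have hlog := mul_le_mul_of_nonneg_left (sum_range_one_div_add_one_le K)
      (by positivity : 0 ≤ 2 * Lθ * Real.sqrt Cθ)
    rw [Finset.mul_sum] at hlog
    refine le_trans ?_ (add_le_add le_rfl hlog)
    rw [← Finset.sum_add_distrib]
    refine Finset.sum_le_sum fun k hk => ?_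
    have h₁ := (abs_le.1 (hAssB _ (hxx (k + 1)) y hy _ (hθθ (k + 1)) _ hθstar)).1
    have h₂ := (abs_le.1 (hAssB x hx _ (hyy (k + 1)) _ (hθθ (k + 1)) _ hθstar)).2
    have h₃ := mul_le_mul_of_nonneg_left (hθrate' k) hLθ
    have h₄ : ts k * (2 * (Lθ * (Real.sqrt Cθ / ((k : ℝ) + 1))))
        ≤ 1 * (2 * (Lθ * (Real.sqrt Cθ / ((k : ℝ) + 1)))) := by
      gcongr
      exact ht1 k (Finset.mem_range.1 hk)
    have h₅ : 1 * (2 * (Lθ * (Real.sqrt Cθ / ((k : ℝ) + 1))))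
        = 2 * Lθ * Real.sqrt Cθ * (1 / ((k : ℝ) + 1)) := by ring
    rw [← h₅]
    refine le_trans ?_ (add_le_add le_rfl h₄)
    rw [← mul_add]
    exact mul_le_mul_of_nonneg_left (by linarith) (htpos k).le
  have hJx := ((hfconv.add (hΦconvx y hy θstar hθstar)).map_centerMass_le
    (t := Finset.range K) (w := ts) (p := fun k => xx (k + 1)) (fun k _ => (htpos k).le)
    (hTK ▸ hTKpos) (fun k _ => hxx (k + 1)))
  have hJy := ((hhconv.sub (hΦconcy x hx θstar hθstar)).map_centerMass_le
    (t := Finset.range K) (w := ts) (p := fun k => yy (k + 1)) (fun k _ => (htpos k).le)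
    (hTK ▸ hTKpos) (fun k _ => hyy (k + 1)))
  simp only [Finset.centerMass, ← hTK, ← hxb, ← hyb, Pi.add_apply, Pi.sub_apply,
    Function.comp_apply, smul_eq_mul] at hJx hJy
  rw [inv_mul_eq_div, le_div_iff₀ hTKpos] at hJx hJy
  have hgap : ((f xb + Φ xb y θstar - h y) - (f x + Φ x yb θstar - h yb)) * TK
      ≤ ∑ k ∈ Finset.range K, ts k
        * ((f (xx (k + 1)) + Φ (xx (k + 1)) y θstar - h y)
          - (f x + Φ x (yy (k + 1)) θstar - h (yy (k + 1)))) := by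
    have hsplit : ∑ k ∈ Finset.range K, ts k
        * ((f (xx (k + 1)) + Φ (xx (k + 1)) y θstar - h y)
          - (f x + Φ x (yy (k + 1)) θstar - h (yy (k + 1))))
        = ∑ k ∈ Finset.range K, ts k * (f (xx (k + 1)) + Φ (xx (k + 1)) y θstar)
          + ∑ k ∈ Finset.range K, ts k * (h (yy (k + 1)) - Φ x (yy (k + 1)) θstar)
          - TK * (f x + h y) := by
      rw [hTK, Finset.sum_mul, ← Finset.sum_add_distrib, ← Finset.sum_sub_distrib]
      exact Finset.sum_congr rfl fun k _ => by ring
    rw [hsplit]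
    linarith
  have hRx' := mul_le_mul_of_nonneg_left (hRx x hx) (one_div_pos.2 (hτs 0)).le
  have hRy' := mul_le_mul_of_nonneg_left (hRy y hy) (one_div_pos.2 (hσs 0)).le
  have hfinal : 1 / TK * (1 / τs 0 * Rx + 1 / σs 0 * Ry)
        + 2 * Lθ * Real.sqrt Cθ / TK * (1 + Real.log (K : ℝ))
        + 4 * Cθ * Lyθ ^ 2 * Real.pi ^ 2 / (6 * TK * β)
      = (1 / τs 0 * Rx + 1 / σs 0 * Ry + 2 * Lθ * Real.sqrt Cθ * (1 + Real.log K)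
        + 4 * Cθ * Lyθ ^ 2 / β * (Real.pi ^ 2 / 6)) / TK := by
    have := hτs 0
    have := hσs 0
    field_simp
  rw [hfinal, le_div_iff₀ hTKpos]
  linarith
end
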